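/- Let G be a finitely generated group such that there exists c > 0 with a_n(G) ≥ c·n for all n ≥ 1, and assume hypothesis (★) holds with α ≥ 2. Fix a real x > 0. For each n ≥ 1 let t_n > 0 satisfy W_0(t_n) = n/x. Let (a_n) be a sequence of real numbers and (b_n) a sequence of positive real numbers such that a_n = x·W_{−1}(t_n) + ε_n with ε_n / (n^{(α−1)/(2α)} (ln n)^{(m−1)/(2α)}) → 0, and b_n / ((α(α−1))^{−1/2} · α^{−(m−1)/(2α)} · (x𝒦)^{1/(2α)} · n^{(α−1)/(2α)} · (ln n)^{(m−1)/(2α)}) → 1. Then for every real s, lim_{n→∞} ln E[exp(s·(K_{G,n} − a_n)/b_n)] = s²/2. -/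

import Mathlib

open scoped BigOperators

/-- `a_n(G)`: the number of subgroups of `G` of index exactly `n`. -/
noncomputable def aCount (G : Type*) [Group G] (n : ℕ) : ℕ :=
  Nat.card {H : Subgroup G // H.index = n}

/-- `c(φ)`: the number of orbits of the action of `G` on `Fin n` induced by
`φ : G →* Equiv.Perm (Fin n)` (equivalently, the orbits of the range of `φ`). -/
noncomputable def numOrbits {G : Type*} [Group G] {n : ℕ} (φ : G →* Equiv.Perm (Fin n)) : ℕ :=
  Nat.card (Quotient (MulAction.orbitRel φ.range (Fin n)))

/-- The expectation `E[f(K_{G,n})]` for the `x`-biased measure on `Hom(G, S_n)`. -/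
noncomputable def expVal (G : Type*) [Group G] (n : ℕ) (x : ℝ) (f : ℝ → ℝ) : ℝ :=
  (∑ᶠ φ : G →* Equiv.Perm (Fin n), f (numOrbits φ) * x ^ numOrbits φ) /
    (∑ᶠ φ : G →* Equiv.Perm (Fin n), x ^ numOrbits φ)

/-- `W_β(u) = ∑_{δ ≥ 1} δ^β a_δ(G) e^{-δu}`. -/
noncomputable def Wfun (G : Type*) [Group G] (β : ℝ) (u : ℝ) : ℝ :=
  ∑' δ : ℕ, ((δ : ℝ) + 1) ^ β * (aCount G (δ + 1) : ℝ) * Real.exp (-((δ : ℝ) + 1) * u)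

section Combinatorics

variable {G : Type*} [Group G]

theorem finite_monoidHom_of_fg [Group.FG G] (M : Type*) [Group M] [Finite M] :
    Finite (G →* M) := by
  obtain ⟨_, S, -, hS⟩ := Group.fg_iff'.1 ‹Group.FG G›
  refine Finite.of_injective (fun (f : G →* M) (s : S) => f s) fun f g h => ?_
  exact MonoidHom.eq_of_eqOn_dense hS fun s hs => congrFun h ⟨s, hs⟩

/-- The number of orbits of a permutation representation on an arbitrary type. -/
noncomputable def orbitCount {X : Type*} (φ : G →* Equiv.Perm X) : ℕ :=
  Nat.card (Quotient (MulAction.orbitRel φ.range X))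

theorem orbitRel_range_iff {X : Type*} (φ : G →* Equiv.Perm X) (i j : X) :
    (MulAction.orbitRel φ.range X) i j ↔ ∃ g, φ g j = i := by
  rw [MulAction.orbitRel_apply]
  constructor
  · rintro ⟨⟨_, g, rfl⟩, h⟩
    exact ⟨g, h⟩
  · rintro ⟨g, h⟩
    exact ⟨⟨φ g, g, rfl⟩, h⟩

/-- The representation on `X` transported from `G ⧸ H` along a bijection. -/
noncomputable def quotientRep {X : Type*} {H : Subgroup G} (e : G ⧸ H ≃ X) : G →* Equiv.Perm X :=
  e.permCongrHom.toMonoidHom.comp (MulAction.toPermHom G (G ⧸ H))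

theorem quotientRep_apply {X : Type*} {H : Subgroup G} (e : G ⧸ H ≃ X) (g k : G) :
    quotientRep e g (e (k : G ⧸ H)) = e ((g * k : G) : G ⧸ H) := by
  simp [quotientRep, Equiv.permCongrHom]

theorem quotientRep_apply_base {X : Type*} {H : Subgroup G} (e : G ⧸ H ≃ X) {x : X}
    (h : e ((1 : G) : G ⧸ H) = x) (g : G) : quotientRep e g x = e (g : G ⧸ H) := by
  rw [← h, quotientRep_apply, mul_one]

theorem card_pointed_equiv {X Y : Type*} [Finite X] (k : ℕ) (hX : Nat.card X = k + 1)
    (hY : Nat.card Y = k + 1) (x : X) (y : Y) :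
    Nat.card {e : X ≃ Y // e x = y} = k.factorial := by
  classical
  have : Finite Y := Nat.finite_of_card_ne_zero (by omega)
  have e0 : X ≃ Option {z : X // z ≠ x} := (Equiv.optionSubtypeNe x).symm
  have e1 : {e : X ≃ Y // e x = y} ≃ {e : Option {z : X // z ≠ x} ≃ Y // e none = y} :=
    (Equiv.equivCongr (Equiv.optionSubtypeNe x).symm (Equiv.refl Y)).subtypeEquiv (by
      intro e
      simp [Equiv.equivCongr])
  rw [Nat.card_congr (e1.trans (Equiv.optionSubtype y))]
  have := Fintype.ofFinite X
  have := Fintype.ofFinite Y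
  have hx : Fintype.card {z : X // z ≠ x} = k := by
    rw [Nat.card_eq_fintype_card] at hX
    simp [Fintype.card_subtype_compl, hX]
  have hy : Fintype.card {z : Y // z ≠ y} = k := by
    rw [Nat.card_eq_fintype_card] at hY
    simp [Fintype.card_subtype_compl, hY]
  rw [Nat.card_eq_fintype_card, Fintype.card_equiv (Fintype.equivOfCardEq (hx.trans hy.symm)), hx]

theorem card_transitive_of_stabilizer {X : Type*} (x : X) (H : Subgroup G) :
    Nat.card {φ : G →* Equiv.Perm X // (∀ j, ∃ g, φ g x = j) ∧ ∀ g, φ g x = x ↔ g ∈ H} =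
      Nat.card {e : G ⧸ H ≃ X // e ((1 : G) : G ⧸ H) = x} := by
  symm
  refine Nat.card_congr (Equiv.ofBijective (fun e => ⟨quotientRep e.1, ?_, ?_⟩) ⟨?_, ?_⟩)
  · intro j
    obtain ⟨q, rfl⟩ := e.1.surjective j
    obtain ⟨k, rfl⟩ := QuotientGroup.mk_surjective q
    exact ⟨k, quotientRep_apply_base e.1 e.2 k⟩
  · intro g
    rw [quotientRep_apply_base e.1 e.2]
    have hx : e.1 (g : G ⧸ H) = x ↔ e.1 (g : G ⧸ H) = e.1 ((1 : G) : G ⧸ H) :=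
      ⟨fun h => h.trans e.2.symm, fun h => h.trans e.2⟩
    rw [hx, e.1.apply_eq_iff_eq, eq_comm, QuotientGroup.eq]
    simp
  · rintro ⟨e, he⟩ ⟨e', he'⟩ h
    have h := congrArg Subtype.val h
    simp only at h
    apply Subtype.ext
    ext q
    obtain ⟨k, rfl⟩ := QuotientGroup.mk_surjective q
    have h1 := quotientRep_apply e k 1
    have h2 := quotientRep_apply e' k 1
    rw [mul_one] at h1 h2
    show e _ = e' _
    rw [← h1, ← h2, h, he, he']
  · rintro ⟨φ, h1, h2⟩
    let f : G ⧸ H → X := Quotient.lift (fun g => φ g x) (by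
      intro a b hab
      have hab : a⁻¹ * b ∈ H := QuotientGroup.leftRel_apply.1 hab
      have := (h2 _).2 hab
      rw [map_mul, map_inv, Equiv.Perm.mul_apply, Equiv.Perm.inv_eq_iff_eq] at this
      exact this.symm)
    have hf : ∀ g : G, f (g : G ⧸ H) = φ g x := fun g => rfl
    have hbij : Function.Bijective f := by
      constructor
      · intro p q hpq
        obtain ⟨a, rfl⟩ := QuotientGroup.mk_surjective p
        obtain ⟨b, rfl⟩ := QuotientGroup.mk_surjective q
        rw [hf, hf] at hpq
        rw [QuotientGroup.eq, ← h2, map_mul, map_inv, Equiv.Perm.mul_apply,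
          Equiv.Perm.inv_eq_iff_eq, hpq]
      · intro j
        obtain ⟨g, hg⟩ := h1 j
        exact ⟨g, hg⟩
    refine ⟨⟨Equiv.ofBijective f hbij, by simp [hf]⟩, ?_⟩
    apply Subtype.ext
    ext g i
    obtain ⟨k, rfl⟩ := h1 i
    have := quotientRep_apply (Equiv.ofBijective f hbij) g k
    simpa [hf] using this

theorem card_transitive {X : Type*} [Finite X] (k : ℕ) (hX : Nat.card X = k + 1) (x : X) :
    Nat.card {φ : G →* Equiv.Perm X // ∀ j, ∃ g, φ g x = j} =
      aCount G (k + 1) * k.factorial := by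
  classical
  let st : (G →* Equiv.Perm X) → Subgroup G := fun φ =>
    (MulAction.stabilizer (Equiv.Perm X) x).comap φ
  have hst : ∀ φ g, g ∈ st φ ↔ φ g x = x := fun φ g => Iff.rfl
  have hidx : ∀ φ : G →* Equiv.Perm X, (∀ j, ∃ g, φ g x = j) → (st φ).index = k + 1 := by
    intro φ hφ
    have h0 : Nonempty {φ' : G →* Equiv.Perm X //
        (∀ j, ∃ g, φ' g x = j) ∧ ∀ g, φ' g x = x ↔ g ∈ st φ} := ⟨φ, hφ, fun g => Iff.rfl⟩
    let : MulAction G X := MulAction.compHom X φ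
    have hsm : ∀ (g : G) (y : X), g • y = φ g y := fun g y => rfl
    have h1 : st φ = MulAction.stabilizer G x := rfl
    have h2 : MulAction.orbit G x = Set.univ := by
      ext j
      simp only [Set.mem_univ, iff_true]
      obtain ⟨g, hg⟩ := hφ j
      exact ⟨g, hg⟩
    rw [h1, Subgroup.index, Nat.card_congr (MulAction.orbitEquivQuotientStabilizer G x).symm, h2,
      Nat.card_congr (Equiv.Set.univ X), hX]
  have key : {φ : G →* Equiv.Perm X // ∀ j, ∃ g, φ g x = j} ≃
      Σ H : {H : Subgroup G // H.index = k + 1},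
        {φ : G →* Equiv.Perm X // (∀ j, ∃ g, φ g x = j) ∧ ∀ g, φ g x = x ↔ g ∈ H.1} :=
    { toFun := fun φ => ⟨⟨st φ.1, hidx _ φ.2⟩, ⟨φ.1, φ.2, fun g => Iff.rfl⟩⟩
      invFun := fun p => ⟨p.2.1, p.2.2.1⟩
      left_inv := fun φ => rfl
      right_inv := by
        rintro ⟨⟨H, hH⟩, ⟨φ, h1, h2⟩⟩
        have : st φ = H := by
          ext g
          exact h2 g
        subst this
        rfl }
  have hfib : ∀ H : {H : Subgroup G // H.index = k + 1},
      Nat.card {φ : G →* Equiv.Perm X // (∀ j, ∃ g, φ g x = j) ∧ ∀ g, φ g x = x ↔ g ∈ H.1} =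
        k.factorial := by
    intro H
    have : Finite (G ⧸ H.1) := Nat.finite_of_card_ne_zero (by
      have := H.2
      rw [Subgroup.index] at this
      omega)
    rw [card_transitive_of_stabilizer, card_pointed_equiv k H.2 hX]
  have hfe : ∀ H : {H : Subgroup G // H.index = k + 1},
      Nonempty ({φ : G →* Equiv.Perm X // (∀ j, ∃ g, φ g x = j) ∧ ∀ g, φ g x = x ↔ g ∈ H.1} ≃
        Fin k.factorial) := by
    intro H
    have := Nat.finite_of_card_ne_zero (by rw [hfib H]; exact Nat.factorial_ne_zero k)
    exact ⟨(Finite.equivFin _).trans (finCongr (hfib H))⟩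
  rw [Nat.card_congr (key.trans ((Equiv.sigmaCongrRight fun H => (hfe H).some).trans
    (Equiv.sigmaEquivProd _ _))), Nat.card_prod, Nat.card_fin, aCount]

/-- The sum of `y ^ c(φ)` over all permutation representations `φ` of `G` on `X`. -/
noncomputable def homWeight (G : Type*) [Group G] (X : Type*) (y : ℝ) : ℝ :=
  ∑ᶠ φ : G →* Equiv.Perm X, y ^ orbitCount φ

theorem orbitCount_congr {X Y : Type*} (e : X ≃ Y) (φ : G →* Equiv.Perm X) :
    orbitCount (e.permCongrHom.toMonoidHom.comp φ) = orbitCount φ := by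
  refine (Nat.card_congr (Quotient.congr e fun i j => ?_)).symm
  change MulAction.orbitRel _ _ i j ↔ MulAction.orbitRel _ _ (e i) (e j)
  rw [orbitRel_range_iff, orbitRel_range_iff]
  simp [Equiv.permCongrHom]

theorem homWeight_congr {X Y : Type*} (e : X ≃ Y) (y : ℝ) : homWeight G X y = homWeight G Y y := by
  refine finsum_eq_of_bijective (fun φ => e.permCongrHom.toMonoidHom.comp φ) ⟨?_, ?_⟩ ?_
  · intro φ ψ h
    ext1 g
    exact e.permCongrHom.injective (DFunLike.congr_fun h g)
  · intro φ
    refine ⟨e.permCongrHom.symm.toMonoidHom.comp φ, ?_⟩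
    ext1 g
    exact e.permCongrHom.apply_symm_apply (φ g)
  · intro φ
    rw [orbitCount_congr]

open Classical in
/-- The representation on `X` glued from representations on a subset and on its complement. -/
noncomputable def glueRep {X : Type*} (p : X → Prop) (ψ : G →* Equiv.Perm {i // p i})
    (χ : G →* Equiv.Perm {i // ¬ p i}) : G →* Equiv.Perm X :=
  (Equiv.Perm.subtypeCongrHom p).comp (ψ.prod χ)

theorem glueRep_apply_left {X : Type*} {p : X → Prop} (ψ : G →* Equiv.Perm {i // p i})
    (χ : G →* Equiv.Perm {i // ¬ p i}) (g : G) (i : {i // p i}) :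
    glueRep p ψ χ g i = ψ g i := by
  classical
  exact Equiv.Perm.subtypeCongr.left_apply (ψ g) (χ g) i.2

theorem glueRep_apply_right {X : Type*} {p : X → Prop} (ψ : G →* Equiv.Perm {i // p i})
    (χ : G →* Equiv.Perm {i // ¬ p i}) (g : G) (i : {i // ¬ p i}) :
    glueRep p ψ χ g i = χ g i := by
  classical
  exact Equiv.Perm.subtypeCongr.right_apply (ψ g) (χ g) i.2

theorem orbitCount_glueRep {X : Type*} [Finite X] {p : X → Prop} (ψ : G →* Equiv.Perm {i // p i})
    (χ : G →* Equiv.Perm {i // ¬ p i}) :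
    orbitCount (glueRep p ψ χ) = orbitCount ψ + orbitCount χ := by
  let f : Quotient (MulAction.orbitRel ψ.range {i // p i}) ⊕
      Quotient (MulAction.orbitRel χ.range {i // ¬ p i}) →
      Quotient (MulAction.orbitRel (glueRep p ψ χ).range X) :=
    Sum.elim
      (Quotient.map Subtype.val fun i j h => by
        obtain ⟨g, hg⟩ := (orbitRel_range_iff _ _ _).1 h
        exact (orbitRel_range_iff _ _ _).2 ⟨g, by rw [glueRep_apply_left, hg]⟩)
      (Quotient.map Subtype.val fun i j h => by
        obtain ⟨g, hg⟩ := (orbitRel_range_iff _ _ _).1 h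
        exact (orbitRel_range_iff _ _ _).2 ⟨g, by rw [glueRep_apply_right, hg]⟩)
  have hf : Function.Bijective f := by
    constructor
    · rintro (a | a) (b | b) h <;> induction a using Quotient.inductionOn with | _ a => ?_ <;>
        induction b using Quotient.inductionOn with | _ b => ?_ <;>
        obtain ⟨g, hg⟩ := (orbitRel_range_iff _ _ _).1 (Quotient.exact h)
      · rw [glueRep_apply_left] at hg
        exact congrArg Sum.inl (Quotient.sound ((orbitRel_range_iff _ _ _).2 ⟨g, Subtype.ext hg⟩))
      · rw [glueRep_apply_right] at hg
        exact absurd a.2 (hg ▸ (χ g b).2)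
      · rw [glueRep_apply_left] at hg
        exact absurd (hg ▸ (ψ g b).2) a.2
      · rw [glueRep_apply_right] at hg
        exact congrArg Sum.inr (Quotient.sound ((orbitRel_range_iff _ _ _).2 ⟨g, Subtype.ext hg⟩))
    · intro q
      induction q using Quotient.inductionOn with | _ i => ?_
      by_cases hi : p i
      · exact ⟨Sum.inl (Quotient.mk _ ⟨i, hi⟩), rfl⟩
      · exact ⟨Sum.inr (Quotient.mk _ ⟨i, hi⟩), rfl⟩
  rw [orbitCount, ← Nat.card_congr (Equiv.ofBijective f hf), Nat.card_sum]
  rfl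

theorem orbitCount_of_transitive {X : Type*} (φ : G →* Equiv.Perm X) (x : X)
    (h : ∀ j, ∃ g, φ g x = j) : orbitCount φ = 1 := by
  rw [orbitCount, Nat.card_eq_one_iff_unique]
  refine ⟨⟨fun a b => ?_⟩, ⟨Quotient.mk _ x⟩⟩
  induction a using Quotient.inductionOn with | _ a => ?_
  induction b using Quotient.inductionOn with | _ b => ?_
  obtain ⟨g, rfl⟩ := h a
  obtain ⟨k, rfl⟩ := h b
  refine Quotient.sound ((orbitRel_range_iff _ _ _).2 ⟨g * k⁻¹, ?_⟩)
  simp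

/-- Representations for which the orbit of `x` is `{i | p i}` are glued from a transitive
representation on that set and an arbitrary one on its complement. -/
noncomputable def glueEquiv {X : Type*} (p : X → Prop) (x : X) (hx : p x) :
    {ψ : G →* Equiv.Perm {i // p i} // ∀ j, ∃ g, ψ g ⟨x, hx⟩ = j} × (G →* Equiv.Perm {i // ¬ p i}) ≃
      {φ : G →* Equiv.Perm X // ∀ j, p j ↔ ∃ g, φ g x = j} :=
  Equiv.ofBijective
    (fun q => ⟨glueRep p q.1.1 q.2, fun j => by
      constructor
      · intro hj
        obtain ⟨g, hg⟩ := q.1.2 ⟨j, hj⟩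
        exact ⟨g, by rw [glueRep_apply_left q.1.1 q.2 g ⟨x, hx⟩, hg]⟩
      · rintro ⟨g, rfl⟩
        rw [glueRep_apply_left q.1.1 q.2 g ⟨x, hx⟩]
        exact (q.1.1 g ⟨x, hx⟩).2⟩)
    (by
      classical
      constructor
      · rintro ⟨⟨ψ, hψ⟩, χ⟩ ⟨⟨ψ', hψ'⟩, χ'⟩ h
        have h := congrArg Subtype.val h
        simp only at h
        have h1 : ψ = ψ' := by
          ext g i
          rw [← glueRep_apply_left ψ χ, h, glueRep_apply_left]
        have h2 : χ = χ' := by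
          ext g i
          rw [← glueRep_apply_right ψ χ, h, glueRep_apply_right]
        subst h1 h2
        rfl
      · rintro ⟨φ, hφ⟩
        have hp : ∀ g i, p (φ g i) ↔ p i := by
          intro g i
          rw [hφ, hφ]
          constructor
          · rintro ⟨k, hk⟩
            exact ⟨g⁻¹ * k, by simp [hk]⟩
          · rintro ⟨k, hk⟩
            exact ⟨g * k, by simp [hk]⟩
        let ψ : G →* Equiv.Perm {i // p i} :=
          { toFun := fun g => (φ g).subtypePerm (hp g)
            map_one' := by ext; simp
            map_mul' := fun a b => by ext; simp only [map_mul]; rfl }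
        let χ : G →* Equiv.Perm {i // ¬ p i} :=
          { toFun := fun g => (φ g).subtypePerm fun i => not_congr (hp g i)
            map_one' := by ext; simp
            map_mul' := fun a b => by ext; simp only [map_mul]; rfl }
        have hψ : ∀ j, ∃ g, ψ g ⟨x, hx⟩ = j := by
          rintro ⟨j, hj⟩
          obtain ⟨g, hg⟩ := (hφ j).1 hj
          exact ⟨g, Subtype.ext hg⟩
        refine ⟨⟨⟨ψ, hψ⟩, χ⟩, Subtype.ext ?_⟩
        ext g i
        by_cases hi : p i
        · exact glueRep_apply_left ψ χ g ⟨i, hi⟩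
        · exact glueRep_apply_right ψ χ g ⟨i, hi⟩)

theorem sum_orbit_eq [Group.FG G] {X : Type*} [Finite X] (p : X → Prop) (x : X) (hx : p x) (k : ℕ)
    (hk : Nat.card {i // p i} = k + 1) (y : ℝ) :
    ∑ᶠ φ : {φ : G →* Equiv.Perm X // ∀ j, p j ↔ ∃ g, φ g x = j}, y ^ orbitCount φ.1 =
      y * (aCount G (k + 1) * k.factorial) * homWeight G {i // ¬ p i} y := by
  have := finite_monoidHom_of_fg (G := G) (Equiv.Perm {i // p i})
  have := finite_monoidHom_of_fg (G := G) (Equiv.Perm {i // ¬ p i})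
  rw [← finsum_comp_equiv (glueEquiv p x hx)]
  have h : ∀ q : {ψ : G →* Equiv.Perm {i // p i} // ∀ j, ∃ g, ψ g ⟨x, hx⟩ = j} ×
      (G →* Equiv.Perm {i // ¬ p i}),
      y ^ orbitCount (glueEquiv p x hx q).1 = y * y ^ orbitCount q.2 := by
    intro q
    change y ^ orbitCount (glueRep p q.1.1 q.2) = _
    rw [orbitCount_glueRep, orbitCount_of_transitive _ _ q.1.2, pow_add, pow_one]
  have := Fintype.ofFinite {ψ : G →* Equiv.Perm {i // p i} // ∀ j, ∃ g, ψ g ⟨x, hx⟩ = j}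
  have := Fintype.ofFinite (G →* Equiv.Perm {i // ¬ p i})
  simp_rw [h]
  rw [finsum_eq_sum_of_fintype, Fintype.sum_prod_type]
  simp only
  rw [Finset.sum_const, Finset.card_univ,
    ← Nat.card_eq_fintype_card, card_transitive k hk, homWeight, finsum_eq_sum_of_fintype,
    ← Finset.mul_sum, nsmul_eq_mul]
  push_cast
  ring

theorem homWeight_succ [Group.FG G] (n : ℕ) (y : ℝ) :
    homWeight G (Fin (n + 1)) y = ∑ k ∈ Finset.range (n + 1),
      (n.choose k : ℝ) * (y * (aCount G (k + 1) * k.factorial)) * homWeight G (Fin (n - k)) y := by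
  classical
  have := finite_monoidHom_of_fg (G := G) (Equiv.Perm (Fin (n + 1)))
  have := Fintype.ofFinite (G →* Equiv.Perm (Fin (n + 1)))
  let o : (G →* Equiv.Perm (Fin (n + 1))) → Finset (Fin (n + 1)) := fun φ =>
    (Finset.univ.erase 0).filter fun j => ∃ g, φ g 0 = j
  have ho : ∀ φ ∈ (Finset.univ : Finset (G →* Equiv.Perm (Fin (n + 1)))),
      o φ ∈ (Finset.univ.erase (0 : Fin (n + 1))).powerset := fun φ _ =>
    Finset.mem_powerset.2 (Finset.filter_subset _ _)
  rw [homWeight, finsum_eq_sum_of_fintype, ← Finset.sum_fiberwise_of_maps_to ho]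
  have hfib : ∀ T ∈ (Finset.univ.erase (0 : Fin (n + 1))).powerset,
      ∑ φ with o φ = T, y ^ orbitCount φ =
        y * (aCount G (T.card + 1) * T.card.factorial) * homWeight G (Fin (n - T.card)) y := by
    intro T hT
    have h0 : (0 : Fin (n + 1)) ∉ T := fun h => by
      simpa using Finset.mem_powerset.1 hT h
    have hcard : Nat.card {i // i ∈ insert 0 T} = T.card + 1 := by
      rw [Nat.card_eq_fintype_card, Fintype.card_coe, Finset.card_insert_of_notMem h0]
    have hcard' : Nat.card {i // ¬ i ∈ insert 0 T} = n - T.card := by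
      rw [Nat.card_eq_fintype_card, Fintype.card_subtype_compl, Fintype.card_coe,
        Finset.card_insert_of_notMem h0, Fintype.card_fin]
      omega
    have hset : ∀ φ : G →* Equiv.Perm (Fin (n + 1)),
        o φ = T ↔ ∀ j, j ∈ insert 0 T ↔ ∃ g, φ g 0 = j := by
      intro φ
      rw [Finset.ext_iff]
      refine forall_congr' fun j => ?_
      by_cases hj : j = 0
      · subst hj
        simp only [o, Finset.mem_filter, Finset.mem_erase, ne_eq, not_true_eq_false, false_and,
          h0, Finset.mem_insert, true_or, true_iff]
        exact ⟨1, by simp⟩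
      · simp only [o, Finset.mem_filter, Finset.mem_erase, ne_eq, hj, not_false_eq_true,
          Finset.mem_univ, true_and, Finset.mem_insert, false_or]
        tauto
    rw [← homWeight_congr ((Finite.equivFin {i // ¬ i ∈ insert 0 T}).trans (finCongr hcard')),
      ← sum_orbit_eq (fun i => i ∈ insert 0 T) 0 (Finset.mem_insert_self _ _) T.card hcard,
      finsum_eq_sum_of_fintype]
    simp_rw [hset]
    exact (Finset.sum_subtype_eq_sum_filter _).symm.trans (by simp)
  rw [Finset.sum_congr rfl hfib, Finset.sum_powerset_apply_card
    (fun k => y * (aCount G (k + 1) * k.factorial) * homWeight G (Fin (n - k)) y)]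
  simp only [Finset.card_erase_of_mem (Finset.mem_univ (0 : Fin (n + 1))), Finset.card_univ,
    Fintype.card_fin, Nat.add_sub_cancel, nsmul_eq_mul, mul_assoc]

theorem homWeight_zero (y : ℝ) : homWeight G (Fin 0) y = 1 := by
  have : Subsingleton (G →* Equiv.Perm (Fin 0)) := ⟨fun f g => by ext a i; exact i.elim0⟩
  have : Unique (G →* Equiv.Perm (Fin 0)) := ⟨⟨1⟩, fun f => Subsingleton.elim _ _⟩
  rw [homWeight, finsum_unique, orbitCount]
  have : IsEmpty (Quotient (MulAction.orbitRel
      (default : G →* Equiv.Perm (Fin 0)).range (Fin 0))) :=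
    ⟨fun q => by induction q using Quotient.inductionOn with | _ i => exact i.elim0⟩
  simp

theorem homWeight_pos [Group.FG G] (X : Type*) [Finite X] {y : ℝ} (hy : 0 < y) :
    0 < homWeight G X y := by
  have := finite_monoidHom_of_fg (G := G) (Equiv.Perm X)
  have := Fintype.ofFinite (G →* Equiv.Perm X)
  rw [homWeight, finsum_eq_sum_of_fintype]
  exact Finset.sum_pos (fun φ _ => pow_pos hy _) ⟨1, Finset.mem_univ _⟩

end Combinatorics

section Kernel

open MeasureTheory Set Filter Topology

/-- The Fejér kernel as the Fourier transform of the triangle function on `[-1, 1]`. -/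
noncomputable def fejer (v : ℝ) : ℝ := ∫ τ in (-1 : ℝ)..1, (1 - |τ|) * Real.cos (τ * v)

theorem fejer_neg (v : ℝ) : fejer (-v) = fejer v := by
  simp [fejer]

theorem fejer_zero : fejer 0 = 1 := by
  have h : ∫ τ in (-1 : ℝ)..1, |τ| = 1 := by
    rw [← intervalIntegral.integral_add_adjacent_intervals (b := 0)
      (continuous_abs.intervalIntegrable _ _) (continuous_abs.intervalIntegrable _ _),
      intervalIntegral.integral_congr (g := fun τ => -τ) (a := -1) (b := 0),
      intervalIntegral.integral_congr (g := fun τ => τ) (a := 0) (b := 1)]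
    · rw [intervalIntegral.integral_neg]
      simp
      norm_num
    · intro τ hτ
      rw [uIcc_of_le zero_le_one] at hτ
      exact abs_of_nonneg hτ.1
    · intro τ hτ
      rw [uIcc_of_le (by norm_num)] at hτ
      exact abs_of_nonpos hτ.2
  simp only [fejer, mul_zero, Real.cos_zero, mul_one]
  rw [intervalIntegral.integral_sub (by simp) (continuous_abs.intervalIntegrable _ _), h]
  norm_num

theorem fejer_of_ne_zero {v : ℝ} (hv : v ≠ 0) : fejer v = 2 * (1 - Real.cos v) / v ^ 2 := by
  have hpos : ∫ τ in (0 : ℝ)..1, (1 - |τ|) * Real.cos (τ * v) = (1 - Real.cos v) / v ^ 2 := by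
    rw [intervalIntegral.integral_congr (g := fun τ => (1 - τ) * Real.cos (τ * v))]
    · have hd : ∀ τ ∈ uIcc (0 : ℝ) 1, HasDerivAt
          (fun τ => (1 - τ) * (Real.sin (τ * v) / v) - Real.cos (τ * v) / v ^ 2)
          ((1 - τ) * Real.cos (τ * v)) τ := by
        intro τ _
        have h1 : HasDerivAt (fun τ : ℝ => τ * v) v τ := by
          simpa using (hasDerivAt_id τ).mul_const v
        have h2 := (((hasDerivAt_id τ).const_sub 1).mul (h1.sin.div_const v)).sub
          (h1.cos.div_const (v ^ 2))
        refine h2.congr_deriv ?_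
        simp only [id]
        field_simp
        ring
      rw [intervalIntegral.integral_eq_sub_of_hasDerivAt hd
        ((by fun_prop : Continuous fun τ : ℝ => (1 - τ) * Real.cos (τ * v)).intervalIntegrable _ _)]
      simp
      ring
    · intro τ hτ
      rw [uIcc_of_le zero_le_one] at hτ
      simp only [abs_of_nonneg hτ.1]
  have hcont : Continuous fun τ : ℝ => (1 - |τ|) * Real.cos (τ * v) := by fun_prop
  have hneg : ∫ τ in (-1 : ℝ)..0, (1 - |τ|) * Real.cos (τ * v) = (1 - Real.cos v) / v ^ 2 := by
    have h := intervalIntegral.integral_comp_neg (a := -1) (b := 0)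
      fun τ => (1 - |τ|) * Real.cos (τ * v)
    simp only [abs_neg, neg_mul, Real.cos_neg, neg_neg, neg_zero] at h
    rw [h, hpos]
  rw [fejer, ← intervalIntegral.integral_add_adjacent_intervals (b := 0)
    (hcont.intervalIntegrable _ _) (hcont.intervalIntegrable _ _), hpos, hneg]
  ring

theorem fejer_nonneg (v : ℝ) : 0 ≤ fejer v := by
  by_cases hv : v = 0
  · rw [hv, fejer_zero]; exact zero_le_one
  · rw [fejer_of_ne_zero hv]
    have := Real.cos_le_one v
    exact div_nonneg (by linarith) (sq_nonneg v)

theorem continuous_fejer : Continuous fejer := by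
  unfold fejer
  exact intervalIntegral.continuous_parametric_intervalIntegral_of_continuous' (by fun_prop) _ _

theorem fejer_le_two (v : ℝ) : fejer v ≤ 2 := by
  have h : ‖fejer v‖ ≤ 1 * |1 - (-1 : ℝ)| := by
    refine intervalIntegral.norm_integral_le_of_norm_le_const fun τ hτ => ?_
    rw [uIoc_of_le (by norm_num)] at hτ
    rw [norm_mul, Real.norm_eq_abs, Real.norm_eq_abs]
    have h1 : |τ| ≤ 1 := abs_le.2 ⟨hτ.1.le, hτ.2⟩
    have h2 : |(1 - |τ| : ℝ)| ≤ 1 := abs_le.2 ⟨by linarith, by linarith [abs_nonneg τ]⟩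
    exact mul_le_one₀ h2 (abs_nonneg _) (Real.abs_cos_le_one _)
  have := (le_abs_self _).trans h
  norm_num at this
  exact this

theorem integrable_fejer : Integrable fejer := by
  refine (integrable_inv_one_add_sq.const_mul 8).mono' continuous_fejer.aestronglyMeasurable
    (Eventually.of_forall fun v => ?_)
  rw [Real.norm_of_nonneg (fejer_nonneg v), ← div_eq_mul_inv, le_div_iff₀ (by positivity)]
  by_cases hv : v = 0
  · rw [hv, fejer_zero]; norm_num
  · have h1 := fejer_le_two v
    have h2 : fejer v * v ^ 2 ≤ 4 := by
      rw [fejer_of_ne_zero hv, div_mul_cancel₀ _ (pow_ne_zero 2 hv)]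
      linarith [Real.neg_one_le_cos v]
    nlinarith

theorem integral_fejer_pos : 0 < ∫ v, fejer v :=
  integral_pos_of_integrable_nonneg_nonzero (x := 0) continuous_fejer integrable_fejer
    fejer_nonneg (by rw [fejer_zero]; exact one_ne_zero)

theorem fejer_eq_integral_cexp (v : ℝ) :
    (fejer v : ℂ) = ∫ τ in (-1 : ℝ)..1, ((1 - |τ| : ℝ) : ℂ) * Complex.exp (Complex.I * τ * v) := by
  have h1 : ∀ τ : ℝ, ((1 - |τ| : ℝ) : ℂ) * Complex.exp (Complex.I * τ * v) =
      (((1 - |τ|) * Real.cos (τ * v) : ℝ) : ℂ) +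
        (((1 - |τ|) * Real.sin (τ * v) : ℝ) : ℂ) * Complex.I := by
    intro τ
    rw [show Complex.I * τ * v = ((τ * v : ℝ) : ℂ) * Complex.I by push_cast; ring,
      Complex.exp_mul_I]
    push_cast
    ring
  have h2 : ∫ τ in (-1 : ℝ)..1, (1 - |τ|) * Real.sin (τ * v) = 0 := by
    have h := intervalIntegral.integral_comp_neg (a := -1) (b := 1)
      fun τ => (1 - |τ|) * Real.sin (τ * v)
    simp only [abs_neg, neg_mul, Real.sin_neg, mul_neg, intervalIntegral.integral_neg,
      neg_neg] at h
    linarith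
  simp_rw [h1]
  rw [intervalIntegral.integral_add, intervalIntegral.integral_mul_const,
    intervalIntegral.integral_ofReal, intervalIntegral.integral_ofReal, h2, fejer]
  · simp
  · exact (by fun_prop : Continuous fun τ : ℝ =>
      (((1 - |τ|) * Real.cos (τ * v) : ℝ) : ℂ)).intervalIntegrable _ _
  · exact (by fun_prop : Continuous fun τ : ℝ =>
      (((1 - |τ|) * Real.sin (τ * v) : ℝ) : ℂ) * Complex.I).intervalIntegrable _ _

theorem integral_fejer_eq {X : Type*} [MeasurableSpace X] (μ : Measure X) [SFinite μ]
    {ℓ : X → ℝ} (hℓ : Measurable ℓ) {w : X → ℝ} (hw : Integrable w μ) (r V : ℝ) :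
    ((∫ x, w x * fejer (r * (V - ℓ x)) ∂μ : ℝ) : ℂ) =
      ∫ τ in (-1 : ℝ)..1, ((1 - |τ| : ℝ) : ℂ) * Complex.exp (Complex.I * τ * (r * V)) *
        ∫ x, (w x : ℂ) * Complex.exp (-(Complex.I * τ * r * ℓ x)) ∂μ := by
  have h1 : ∀ x, ((w x * fejer (r * (V - ℓ x)) : ℝ) : ℂ) = ∫ τ in Ioc (-1 : ℝ) 1,
      ((1 - |τ| : ℝ) : ℂ) * Complex.exp (Complex.I * τ * (r * V)) *
        ((w x : ℂ) * Complex.exp (-(Complex.I * τ * r * ℓ x))) := by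
    intro x
    rw [Complex.ofReal_mul, fejer_eq_integral_cexp, intervalIntegral.integral_of_le (by norm_num),
      ← integral_const_mul]
    refine integral_congr_ae (Eventually.of_forall fun τ => ?_)
    simp only
    rw [show Complex.I * τ * ((r * (V - ℓ x) : ℝ) : ℂ) =
      Complex.I * τ * (r * V) + -(Complex.I * τ * r * ℓ x) by push_cast; ring, Complex.exp_add]
    ring
  rw [← integral_complex_ofReal]
  simp_rw [h1]
  rw [intervalIntegral.integral_of_le (by norm_num), integral_integral_swap]
  · simp_rw [integral_const_mul]
  · have hb : Integrable (fun τ : ℝ => ((1 - |τ| : ℝ) : ℂ)) (volume.restrict (Ioc (-1 : ℝ) 1)) :=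
      ((by fun_prop : Continuous fun τ : ℝ => ((1 - |τ| : ℝ) : ℂ)).integrableOn_Icc
        (a := -1) (b := 1)).mono_set Ioc_subset_Icc_self
    have hp := (hw.ofReal (𝕜 := ℂ)).mul_prod hb
    have hm : Measurable fun z : X × ℝ => Complex.exp (Complex.I * z.2 * (r * V)) *
        Complex.exp (-(Complex.I * z.2 * r * ℓ z.1)) := by fun_prop
    refine (hp.mul_bdd (c := 1) hm.aestronglyMeasurable (Eventually.of_forall fun z => ?_)).congr
      (Eventually.of_forall fun z => ?_)
    · rw [← Complex.exp_add, Complex.norm_exp]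
      simp
    · simp only [Function.uncurry]
      simp
      ring

end Kernel

section SmoothedSum

open MeasureTheory Set Filter Topology

theorem integrableOn_pow_mul_cexp_neg {z : ℂ} (hz : 0 < z.re) (n : ℕ) :
    IntegrableOn (fun v : ℝ => (v : ℂ) ^ n * Complex.exp (-(z * v))) (Ioi 0) := by
  have h := integrableOn_rpow_mul_exp_neg_mul_rpow (p := 1) (s := n) (b := z.re)
    (by have : (0 : ℝ) ≤ n := n.cast_nonneg; linarith) one_pos hz
  refine h.mono' (by fun_prop) ?_
  filter_upwards [ae_restrict_mem measurableSet_Ioi] with v hv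
  rw [norm_mul, norm_pow, Complex.norm_real, Real.norm_of_nonneg (le_of_lt hv), Complex.norm_exp,
    Real.rpow_natCast, Real.rpow_one]
  simp

theorem integral_pow_mul_cexp_neg {z : ℂ} (hz : 0 < z.re) (n : ℕ) :
    ∫ v in Ioi (0 : ℝ), (v : ℂ) ^ n * Complex.exp (-(z * v)) = n.factorial / z ^ (n + 1) := by
  have hz0 : z ≠ 0 := by rintro rfl; simp at hz
  have hd : ∀ v : ℝ, HasDerivAt (fun v : ℝ => Complex.exp (-(z * v)))
      (-z * Complex.exp (-(z * v))) v := by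
    intro v
    have h1 : HasDerivAt (fun v : ℝ => -(z * (v : ℂ))) (-z) v := by
      simpa using ((Complex.ofRealCLM.hasDerivAt (x := v)).const_mul z).fun_neg
    exact h1.cexp.congr_deriv (by ring)
  have hlim : ∀ n : ℕ, Tendsto (fun v : ℝ => (v : ℂ) ^ n * Complex.exp (-(z * v))) atTop (𝓝 0) := by
    intro n
    rw [tendsto_zero_iff_norm_tendsto_zero]
    have := Real.tendsto_pow_mul_exp_neg_atTop_nhds_zero n
    have h1 : Tendsto (fun v : ℝ => z.re * v) atTop atTop := tendsto_id.const_mul_atTop hz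
    have h2 := (this.comp h1).const_mul ((z.re ^ n)⁻¹)
    rw [mul_zero] at h2
    refine h2.congr' ?_
    filter_upwards [eventually_ge_atTop 0] with v hv
    rw [norm_mul, norm_pow, Complex.norm_real, Real.norm_of_nonneg hv, Complex.norm_exp]
    simp only [Function.comp, mul_pow]
    rw [← mul_assoc, ← mul_assoc, inv_mul_cancel₀ (pow_ne_zero n hz.ne'), one_mul]
    simp
  induction n with
  | zero =>
    have h := integral_Ioi_of_hasDerivAt_of_tendsto' (a := 0)
      (f := fun v : ℝ => Complex.exp (-(z * v))) (fun v _ => hd v)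
      (by simpa [IntegrableOn] using (integrableOn_pow_mul_cexp_neg hz 0).const_mul (-z))
      (by simpa using hlim 0)
    rw [integral_const_mul] at h
    simp only [pow_zero, one_mul]
    field_simp
    simp only [Complex.ofReal_zero, mul_zero, neg_zero, Complex.exp_zero, zero_sub, neg_mul,
      neg_inj] at h
    simpa [mul_comm] using h
  | succ n ih =>
    have hd' : ∀ v : ℝ, HasDerivAt (fun v : ℝ => (v : ℂ) ^ (n + 1) * Complex.exp (-(z * v)))
        ((n + 1) * ((v : ℂ) ^ n * Complex.exp (-(z * v))) -
          z * ((v : ℂ) ^ (n + 1) * Complex.exp (-(z * v)))) v := by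
      intro v
      have h1 : HasDerivAt (fun v : ℝ => (v : ℂ) ^ (n + 1)) ((n + 1) * (v : ℂ) ^ n) v := by
        simpa using (Complex.ofRealCLM.hasDerivAt (x := v)).fun_pow (n + 1)
      exact (h1.mul (hd v)).congr_deriv (by ring)
    have h := integral_Ioi_of_hasDerivAt_of_tendsto' (a := 0) (fun v _ => hd' v)
      (((integrableOn_pow_mul_cexp_neg hz n).const_mul _).sub
        ((integrableOn_pow_mul_cexp_neg hz (n + 1)).const_mul _)) (hlim (n + 1))
    rw [integral_sub ((integrableOn_pow_mul_cexp_neg hz n).const_mul _)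
        ((integrableOn_pow_mul_cexp_neg hz (n + 1)).const_mul _), integral_const_mul,
        integral_const_mul, ih] at h
    simp only [Complex.ofReal_zero, ne_eq, Nat.add_eq_zero_iff, one_ne_zero, and_false,
      not_false_eq_true, zero_pow, zero_mul, sub_zero, sub_eq_zero] at h
    rw [eq_div_iff (pow_ne_zero _ hz0), pow_succ, ← mul_assoc, mul_right_comm, mul_comm _ z, ← h,
      Nat.factorial_succ]
    field_simp
    push_cast
    ring

/-- The smoothed contribution of the density `v ^ j` on `(0, ∞)`, damped by `e ^ (-ε v)`. -/
noncomputable def smoothedPow (j : ℕ) (r ε V : ℝ) : ℝ :=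
  ∫ v in Ioi (0 : ℝ), v ^ j * Real.exp (-(ε * v)) * fejer (r * (V - v))

theorem integrableOn_pow_mul_exp_neg {ε : ℝ} (hε : 0 < ε) (j : ℕ) :
    IntegrableOn (fun v : ℝ => v ^ j * Real.exp (-(ε * v))) (Ioi 0) := by
  have h := integrableOn_rpow_mul_exp_neg_mul_rpow (p := 1) (s := j) (b := ε)
    (by have : (0 : ℝ) ≤ j := j.cast_nonneg; linarith) one_pos hε
  simpa using h

theorem smoothedPow_eq {ε : ℝ} (hε : 0 < ε) (j : ℕ) (r V : ℝ) :
    (smoothedPow j r ε V : ℂ) =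
      ∫ τ in (-1 : ℝ)..1, ((1 - |τ| : ℝ) : ℂ) * Complex.exp (Complex.I * τ * (r * V)) *
        (j.factorial / (ε + Complex.I * τ * r) ^ (j + 1)) := by
  rw [smoothedPow, integral_fejer_eq (volume.restrict (Ioi (0 : ℝ))) (ℓ := fun v => v) measurable_id
    (integrableOn_pow_mul_exp_neg hε j)]
  refine intervalIntegral.integral_congr fun τ _ => ?_
  rw [← integral_pow_mul_cexp_neg (z := ε + Complex.I * τ * r) (by simpa using hε)]
  congr 2
  ext v
  push_cast
  rw [mul_assoc, ← Complex.exp_add]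
  congr 2
  ring

theorem pow_mul_exp_neg_le (j : ℕ) {y : ℝ} (hy : 0 ≤ y) :
    y ^ j * Real.exp (-y) ≤ j.factorial := by
  have h := Real.pow_div_factorial_le_exp y hy j
  rw [div_le_iff₀ (by positivity)] at h
  rw [Real.exp_neg, ← div_eq_mul_inv, div_le_iff₀ (Real.exp_pos y)]
  linarith

theorem integrable_fejer_mul {r : ℝ} (hr : r ≠ 0) : Integrable fun u => fejer (r * u) :=
  integrable_fejer.comp_mul_left' hr

theorem smoothedPow_nonneg (j : ℕ) (r ε V : ℝ) : 0 ≤ smoothedPow j r ε V :=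
  setIntegral_nonneg measurableSet_Ioi fun _ hv =>
    mul_nonneg (mul_nonneg (pow_nonneg (le_of_lt hv) _) (Real.exp_pos _).le) (fejer_nonneg _)

theorem smoothedPow_div_eq (j : ℕ) (r V' V : ℝ) :
    smoothedPow j r (1 / V) V' / V ^ j = ∫ u, (Iio V').indicator
      (fun u => ((V' - u) / V) ^ j * Real.exp (-((V' - u) / V)) * fejer (r * u)) u := by
  rw [smoothedPow, ← integral_indicator measurableSet_Ioi, ← integral_sub_left_eq_self _ _ V',
    div_eq_mul_inv, ← integral_mul_const]
  refine integral_congr_ae (Eventually.of_forall fun u => ?_)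
  simp only [indicator, mem_Ioi, sub_pos, mem_Iio, ite_mul, zero_mul]
  refine if_congr Iff.rfl ?_ rfl
  rw [show V' - (V' - u) = u by ring, div_pow, show 1 / V * (V' - u) = (V' - u) / V by ring]
  ring

theorem norm_smoothedPow_integrand_le (j : ℕ) (r V' : ℝ) {V : ℝ} (hV : 0 < V) (u : ℝ) :
    ‖(Iio V').indicator
      (fun u => ((V' - u) / V) ^ j * Real.exp (-((V' - u) / V)) * fejer (r * u)) u‖ ≤
      j.factorial * fejer (r * u) := by
  by_cases hu : u ∈ Iio V'
  · have h0 : 0 ≤ (V' - u) / V := div_nonneg (sub_nonneg.2 (le_of_lt hu)) hV.le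
    rw [indicator_of_mem hu, norm_mul, Real.norm_of_nonneg (fejer_nonneg _),
      Real.norm_of_nonneg (mul_nonneg (pow_nonneg h0 _) (Real.exp_pos _).le)]
    exact mul_le_mul_of_nonneg_right (pow_mul_exp_neg_le j h0) (fejer_nonneg _)
  · rw [indicator_of_notMem hu, norm_zero]
    exact mul_nonneg (Nat.cast_nonneg _) (fejer_nonneg _)

theorem smoothedPow_le (j : ℕ) {r : ℝ} (hr : r ≠ 0) (V' : ℝ) {V : ℝ} (hV : 0 < V) :
    smoothedPow j r (1 / V) V' / V ^ j ≤ j.factorial * ∫ u, fejer (r * u) := by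
  rw [smoothedPow_div_eq j r V' V, ← integral_const_mul]
  refine (le_abs_self _).trans (norm_integral_le_of_norm_le ((integrable_fejer_mul hr).const_mul _)
    (Eventually.of_forall fun u => norm_smoothedPow_integrand_le j r V' hV u))

theorem tendsto_smoothedPow (j : ℕ) {r : ℝ} (hr : r ≠ 0) (w : ℝ) :
    Tendsto (fun V : ℝ => smoothedPow j r (1 / V) (V + w) / V ^ j) atTop
      (𝓝 (Real.exp (-1) * ∫ u, fejer (r * u))) := by
  rw [← integral_const_mul]
  have h := tendsto_integral_filter_of_dominated_convergence (l := (atTop : Filter ℝ))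
    (F := fun (V u : ℝ) => (Iio (V + w)).indicator
      (fun u => ((V + w - u) / V) ^ j * Real.exp (-((V + w - u) / V)) * fejer (r * u)) u)
    (f := fun u => Real.exp (-1) * fejer (r * u)) (μ := volume)
    (fun u => j.factorial * fejer (r * u)) ?_ ?_ ((integrable_fejer_mul hr).const_mul _) ?_
  · refine h.congr' ?_
    filter_upwards [eventually_gt_atTop 0] with V hV
    rw [smoothedPow_div_eq j r (V + w) V]
  · refine Eventually.of_forall fun V => AEStronglyMeasurable.indicator ?_ measurableSet_Iio
    have := continuous_fejer
    exact (by fun_prop : Continuous fun u => ((V + w - u) / V) ^ j *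
      Real.exp (-((V + w - u) / V)) * fejer (r * u)).aestronglyMeasurable
  · filter_upwards [eventually_gt_atTop 0] with V hV
    exact Eventually.of_forall fun u => norm_smoothedPow_integrand_le j r (V + w) hV u
  · refine Eventually.of_forall fun u => ?_
    have h1 : Tendsto (fun V : ℝ => (V + w - u) / V) atTop (𝓝 1) := by
      have h2 : Tendsto (fun V : ℝ => 1 + (w - u) * V⁻¹) atTop (𝓝 (1 + (w - u) * 0)) :=
        (tendsto_inv_atTop_zero.const_mul _).const_add _
      rw [mul_zero, add_zero] at h2
      refine h2.congr' ?_
      filter_upwards [eventually_gt_atTop 0] with V hV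
      field_simp
      ring
    have h3 : Tendsto (fun V : ℝ => ((V + w - u) / V) ^ j * Real.exp (-((V + w - u) / V)) *
        fejer (r * u)) atTop (𝓝 (1 ^ j * Real.exp (-1) * fejer (r * u))) :=
      ((h1.pow j).mul (Real.continuous_exp.continuousAt.tendsto.comp h1.neg)).mul_const _
    rw [one_pow, one_mul] at h3
    refine h3.congr' ?_
    filter_upwards [eventually_gt_atTop (u - w)] with V hV
    rw [indicator_of_mem]
    simp only [mem_Iio]
    linarith

end SmoothedSum

section PoleExpansion

open MeasureTheory Set Filter Topology

/-- The Dirichlet series of a nonnegative sequence converges to the right of `α` and is there the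
sum of its polar part at `α`, of order `k + 1`, and a function continuous up to the abscissa. -/
structure HasPoleExpansion (A : ℕ → ℝ) (α : ℝ) (k : ℕ) (c : ℕ → ℂ) (Φ : ℂ → ℂ) : Prop where
  nonneg : ∀ δ, 0 ≤ A δ
  continuousOn : ContinuousOn Φ {s : ℂ | α ≤ s.re}
  summable : ∀ σ, α < σ → Summable fun δ : ℕ => A δ * Real.exp (-(σ * Real.log (δ + 1)))
  tsum_eq : ∀ s : ℂ, α < s.re →
    ∑' δ : ℕ, (A δ : ℂ) * Complex.exp (-(s * Real.log (δ + 1))) =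
      (∑ j ∈ Finset.range (k + 1), c j / (s - α) ^ (j + 1)) + Φ s

/-- The Dirichlet series weighted by the Fejér kernel centred at `V` on the logarithmic scale. -/
noncomputable def smoothedSum (A : ℕ → ℝ) (σ r V : ℝ) : ℝ :=
  ∑' δ : ℕ, A δ * Real.exp (-(σ * Real.log (δ + 1))) * fejer (r * (V - Real.log (δ + 1)))

/-- The contribution of the regular part to the smoothed sum. -/
noncomputable def smoothedRegular (Φ : ℂ → ℂ) (σ r V : ℝ) : ℂ :=
  ∫ τ in (-1 : ℝ)..1, ((1 - |τ| : ℝ) : ℂ) * Complex.exp (Complex.I * τ * (r * V)) *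
    Φ (σ + Complex.I * τ * r)

variable {A : ℕ → ℝ} {α : ℝ} {k : ℕ} {c : ℕ → ℂ} {Φ : ℂ → ℂ}

theorem HasPoleExpansion.summable_smoothedSum (h : HasPoleExpansion A α k c Φ) {σ : ℝ}
    (hσ : α < σ) (r V : ℝ) : Summable fun δ : ℕ =>
      A δ * Real.exp (-(σ * Real.log (δ + 1))) * fejer (r * (V - Real.log (δ + 1))) := by
  refine ((h.summable σ hσ).mul_right 2).of_nonneg_of_le (fun δ => ?_) (fun δ => ?_)
  · exact mul_nonneg (mul_nonneg (h.nonneg δ) (Real.exp_pos _).le) (fejer_nonneg _)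
  · exact mul_le_mul_of_nonneg_left (fejer_le_two _)
      (mul_nonneg (h.nonneg δ) (Real.exp_pos _).le)

theorem HasPoleExpansion.smoothedSum_nonneg (h : HasPoleExpansion A α k c Φ) (σ r V : ℝ) :
    0 ≤ smoothedSum A σ r V :=
  tsum_nonneg fun δ =>
    mul_nonneg (mul_nonneg (h.nonneg δ) (Real.exp_pos _).le) (fejer_nonneg _)

theorem continuous_comp_vertical (hΦ : ContinuousOn Φ {s : ℂ | α ≤ s.re}) {σ : ℝ} (hσ : α ≤ σ)
    (r : ℝ) : Continuous fun τ : ℝ => Φ (σ + Complex.I * τ * r) :=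
  hΦ.comp_continuous (by fun_prop) fun τ => by simpa using hσ

theorem HasPoleExpansion.smoothedSum_eq (h : HasPoleExpansion A α k c Φ) {ε : ℝ} (hε : 0 < ε)
    (r V : ℝ) : (smoothedSum A (α + ε) r V : ℂ) =
      (∑ j ∈ Finset.range (k + 1), c j / j.factorial * smoothedPow j r ε V) +
        smoothedRegular Φ (α + ε) r V := by
  have hσ : α < α + ε := by linarith
  have hsm := h.summable _ hσ
  have hint : Integrable (fun δ : ℕ => A δ * Real.exp (-((α + ε) * Real.log (δ + 1))))
      Measure.count := by
    rw [integrable_count_iff]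
    exact hsm.norm
  have hleft : smoothedSum A (α + ε) r V = ∫ δ : ℕ, A δ *
      Real.exp (-((α + ε) * Real.log (δ + 1))) * fejer (r * (V - Real.log (δ + 1)))
        ∂Measure.count := by
    rw [integral_countable]
    · simp [smoothedSum]
    · rw [integrable_count_iff]
      exact (h.summable_smoothedSum hσ r V).norm
  have hright : ∀ τ : ℝ, ∫ δ : ℕ, ((A δ * Real.exp (-((α + ε) * Real.log (δ + 1))) : ℝ) : ℂ) *
      Complex.exp (-(Complex.I * τ * r * Real.log (δ + 1))) ∂Measure.count =
      (∑ j ∈ Finset.range (k + 1), c j / (ε + Complex.I * τ * r) ^ (j + 1)) +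
        Φ ((α + ε : ℝ) + Complex.I * τ * r) := by
    intro τ
    rw [integral_countable]
    · have h1 := h.tsum_eq ((α + ε : ℝ) + Complex.I * τ * r) (by simpa using hε)
      rw [show ((α + ε : ℝ) + Complex.I * τ * r - α : ℂ) = ε + Complex.I * τ * r by
        push_cast; ring] at h1
      rw [← h1]
      refine tsum_congr fun δ => ?_
      simp only [measureReal_def, Measure.count_singleton, ENNReal.toReal_one, one_smul]
      push_cast
      rw [mul_assoc, ← Complex.exp_add]
      congr 2
      ring
    · rw [integrable_count_iff]
      refine hsm.congr fun δ => ?_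
      rw [norm_mul, Complex.norm_real, Complex.norm_exp, Real.norm_of_nonneg
        (mul_nonneg (h.nonneg δ) (Real.exp_pos _).le)]
      simp
  have hne : ∀ τ : ℝ, (ε + Complex.I * τ * r : ℂ) ≠ 0 := by
    intro τ h0
    have := congrArg Complex.re h0
    simp at this
    exact hε.ne' this
  have hcont : ∀ j, Continuous fun τ : ℝ => ((1 - |τ| : ℝ) : ℂ) *
      Complex.exp (Complex.I * τ * (r * V)) *
        (j.factorial / (ε + Complex.I * τ * r) ^ (j + 1) : ℂ) := by
    intro j
    refine Continuous.mul (by fun_prop) (Continuous.div (by fun_prop) (by fun_prop) fun τ => ?_)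
    exact pow_ne_zero _ (hne τ)
  have hcΦ := continuous_comp_vertical h.continuousOn hσ.le r
  rw [hleft, integral_fejer_eq Measure.count (ℓ := fun δ : ℕ => Real.log (δ + 1))
    (measurable_of_countable _) hint r V, smoothedRegular]
  simp_rw [hright, smoothedPow_eq hε, ← intervalIntegral.integral_const_mul]
  rw [← intervalIntegral.integral_finsetSum, ← intervalIntegral.integral_add]
  · refine intervalIntegral.integral_congr fun τ _ => ?_
    simp only [mul_add, Finset.mul_sum]
    congr 1
    refine Finset.sum_congr rfl fun j _ => ?_
    have : (j.factorial : ℂ) ≠ 0 := by exact_mod_cast j.factorial_ne_zero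
    field_simp
  · exact (continuous_finsetSum _ fun j _ => (hcont j).const_mul _).intervalIntegrable _ _
  · exact (Continuous.mul (by fun_prop) hcΦ).intervalIntegrable _ _
  · exact fun j _ => ((hcont j).const_mul _).intervalIntegrable _ _

theorem exists_norm_comp_vertical_le (hΦ : ContinuousOn Φ {s : ℂ | α ≤ s.re}) (r : ℝ) :
    ∃ M, 0 ≤ M ∧ ∀ ε ∈ Icc (0 : ℝ) 1, ∀ τ ∈ Icc (-1 : ℝ) 1,
      ‖Φ ((α + ε : ℝ) + Complex.I * τ * r)‖ ≤ M := by
  have hc : ContinuousOn (fun p : ℝ × ℝ => Φ ((α + p.1 : ℝ) + Complex.I * p.2 * r))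
      (Icc (0 : ℝ) 1 ×ˢ Icc (-1 : ℝ) 1) :=
    hΦ.comp (by fun_prop) fun p hp => by simpa using hp.1.1
  obtain ⟨M, hM⟩ := (isCompact_Icc.prod isCompact_Icc).exists_bound_of_continuousOn hc
  exact ⟨M, (norm_nonneg _).trans (hM (0, 0) (by simp)), fun ε hε τ hτ => hM (ε, τ) ⟨hε, hτ⟩⟩

theorem norm_fejer_weight_le {τ : ℝ} (hτ : τ ∈ Icc (-1 : ℝ) 1) (r V : ℝ) :
    ‖((1 - |τ| : ℝ) : ℂ) * Complex.exp (Complex.I * τ * (r * V))‖ ≤ 1 := by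
  have h1 : |τ| ≤ 1 := abs_le.2 hτ
  rw [norm_mul, Complex.norm_real, Complex.norm_exp, Real.norm_of_nonneg (by linarith)]
  have := abs_nonneg τ
  simp

theorem exists_norm_smoothedRegular_le (hΦ : ContinuousOn Φ {s : ℂ | α ≤ s.re}) (r : ℝ) :
    ∃ M, 0 ≤ M ∧ ∀ ε ∈ Icc (0 : ℝ) 1, ∀ V, ‖smoothedRegular Φ (α + ε) r V‖ ≤ M := by
  obtain ⟨M, hM0, hM⟩ := exists_norm_comp_vertical_le hΦ r
  refine ⟨M * |1 - (-1)|, by positivity, fun ε hε V => ?_⟩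
  refine intervalIntegral.norm_integral_le_of_norm_le_const fun τ hτ => ?_
  rw [uIoc_of_le (by norm_num)] at hτ
  have hτ' := Ioc_subset_Icc_self hτ
  rw [norm_mul]
  exact (mul_le_mul (norm_fejer_weight_le hτ' r V) (hM ε hε τ hτ') (norm_nonneg _)
    zero_le_one).trans_eq (one_mul M)

theorem tendsto_smoothedRegular (hΦ : ContinuousOn Φ {s : ℂ | α ≤ s.re}) {r : ℝ} (hr : 0 < r)
    (w : ℝ) :
    Tendsto (fun V : ℝ => smoothedRegular Φ (α + 1 / V) r (V + w)) atTop (𝓝 0) := by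
  obtain ⟨M, hM0, hM⟩ := exists_norm_comp_vertical_le hΦ r
  have hc0 := continuous_comp_vertical hΦ le_rfl r
  have hmem : ∀ V : ℝ, 1 ≤ V → 1 / V ∈ Icc (0 : ℝ) 1 := fun V hV =>
    ⟨by positivity, by rw [div_le_one (by linarith)]; exact hV⟩
  have hRL : Tendsto (fun V : ℝ => smoothedRegular Φ α r (V + w)) atTop (𝓝 0) := by
    have h1 := Real.tendsto_integral_exp_smul_cocompact
      ((Ioc (-1 : ℝ) 1).indicator fun τ : ℝ => ((1 - |τ| : ℝ) : ℂ) * Φ (α + Complex.I * τ * r))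
    have h2 : Tendsto (fun V : ℝ => -(r / (2 * Real.pi)) * (V + w)) atTop (cocompact ℝ) := by
      refine Tendsto.mono_right ?_ atBot_le_cocompact
      exact (tendsto_atTop_add_const_right _ w tendsto_id).const_mul_atTop_of_neg
        (by have := Real.pi_pos; rw [neg_lt_zero]; positivity)
    refine (h1.comp h2).congr fun V => ?_
    rw [smoothedRegular, intervalIntegral.integral_of_le (by norm_num),
      ← integral_indicator measurableSet_Ioc]
    refine integral_congr_ae (Eventually.of_forall fun τ => ?_)
    by_cases hτ : τ ∈ Ioc (-1 : ℝ) 1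
    · simp only [indicator_of_mem hτ]
      rw [Circle.smul_def, Real.fourierChar_apply, smul_eq_mul, mul_comm (Complex.exp _),
        mul_right_comm]
      congr 2
      have : (Real.pi : ℂ) ≠ 0 := by exact_mod_cast Real.pi_ne_zero
      push_cast
      field_simp
    · simp only [indicator_of_notMem hτ, smul_zero]
  have hdiff : Tendsto (fun V : ℝ => smoothedRegular Φ (α + 1 / V) r (V + w) -
      smoothedRegular Φ α r (V + w)) atTop (𝓝 0) := by
    have h1 : Tendsto (fun V : ℝ => ∫ τ in (-1 : ℝ)..1, ((1 - |τ| : ℝ) : ℂ) *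
        Complex.exp (Complex.I * τ * (r * (V + w : ℝ))) *
          (Φ ((α + 1 / V : ℝ) + Complex.I * τ * r) - Φ (α + Complex.I * τ * r))) atTop
        (𝓝 (∫ τ in (-1 : ℝ)..1, (0 : ℂ))) := by
      refine intervalIntegral.tendsto_integral_filter_of_dominated_convergence
        (fun _ => M + M) ?_ ?_ (by simp) ?_
      · filter_upwards [eventually_ge_atTop 1] with V hV
        have := continuous_comp_vertical hΦ (σ := α + 1 / V) (by have := (hmem V hV).1; linarith) r
        exact (Continuous.mul (by fun_prop) (this.sub hc0)).aestronglyMeasurable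
      · filter_upwards [eventually_ge_atTop 1] with V hV
        refine Eventually.of_forall fun τ hτ => ?_
        rw [uIoc_of_le (by norm_num)] at hτ
        have hτ' := Ioc_subset_Icc_self hτ
        rw [norm_mul]
        have h0 := hM 0 (by simp) τ hτ'
        rw [add_zero] at h0
        exact (mul_le_mul (norm_fejer_weight_le hτ' r _) ((norm_sub_le _ _).trans
          (add_le_add (hM _ (hmem V hV) τ hτ') h0)) (norm_nonneg _)
          zero_le_one).trans_eq (one_mul _)
      · refine Eventually.of_forall fun τ hτ => ?_
        rw [uIoc_of_le (by norm_num)] at hτ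
        have hτ' := Ioc_subset_Icc_self hτ
        have h3 : Tendsto (fun V : ℝ => Φ ((α + 1 / V : ℝ) + Complex.I * τ * r)) atTop
            (𝓝 (Φ (α + Complex.I * τ * r))) := by
          refine (hΦ (α + Complex.I * τ * r) (by simp)).tendsto.comp
            (tendsto_nhdsWithin_iff.2 ⟨?_, ?_⟩)
          · have h4 : Tendsto (fun V : ℝ => α + 1 / V) atTop (𝓝 (α + 0)) := by
              simpa using (tendsto_inv_atTop_zero (𝕜 := ℝ)).const_add α
            rw [add_zero] at h4
            exact ((Complex.continuous_ofReal.tendsto _).comp h4).add_const _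
          · filter_upwards [eventually_ge_atTop 1] with V hV
            have := (hmem V hV).1
            simpa using this
        have h5 : Tendsto (fun V : ℝ => Φ ((α + 1 / V : ℝ) + Complex.I * τ * r) -
            Φ (α + Complex.I * τ * r)) atTop (𝓝 0) := by
          simpa using h3.sub_const (Φ (α + Complex.I * τ * r))
        have h6 := h5.norm
        rw [norm_zero] at h6
        refine squeeze_zero_norm (fun V => ?_) h6
        rw [norm_mul]
        exact mul_le_of_le_one_left (norm_nonneg _) (norm_fejer_weight_le hτ' r _)
    rw [intervalIntegral.integral_zero] at h1
    refine h1.congr' ?_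
    filter_upwards [eventually_ge_atTop 1] with V hV
    have := continuous_comp_vertical hΦ (σ := α + 1 / V) (by have := (hmem V hV).1; linarith) r
    rw [smoothedRegular, smoothedRegular, ← intervalIntegral.integral_sub]
    · simp_rw [mul_sub]
    · exact (Continuous.mul (by fun_prop) this).intervalIntegrable _ _
    · exact (Continuous.mul (by fun_prop) hc0).intervalIntegrable _ _
  simpa using hdiff.add hRL

theorem HasPoleExpansion.exists_smoothedSum_le (h : HasPoleExpansion A α k c Φ) {r : ℝ}
    (hr : r ≠ 0) : ∃ C, 0 ≤ C ∧ ∀ V, 1 ≤ V → ∀ V',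
      smoothedSum A (α + 1 / V) r V' / V ^ k ≤ C := by
  obtain ⟨M, hM0, hM⟩ := exists_norm_smoothedRegular_le h.continuousOn r
  have hK : 0 ≤ ∫ u, fejer (r * u) := integral_nonneg fun u => fejer_nonneg _
  refine ⟨(∑ j ∈ Finset.range (k + 1), ‖c j / j.factorial‖ * (j.factorial * ∫ u, fejer (r * u)))
    + M, by positivity, fun V hV V' => ?_⟩
  have hV0 : 0 < V := by linarith
  have hVk : 1 ≤ V ^ k := one_le_pow₀ hV
  have h1 := h.smoothedSum_eq (ε := 1 / V) (by positivity) r V'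
  have h2 : smoothedSum A (α + 1 / V) r V' ≤
      ∑ j ∈ Finset.range (k + 1), ‖c j / j.factorial‖ * smoothedPow j r (1 / V) V' + M := by
    refine (le_abs_self _).trans ?_
    rw [← Real.norm_eq_abs, ← Complex.norm_real, h1]
    refine (norm_add_le _ _).trans (add_le_add ((norm_sum_le _ _).trans_eq ?_)
      (hM _ ⟨by positivity, by rw [div_le_one hV0]; exact hV⟩ V'))
    refine Finset.sum_congr rfl fun j _ => ?_
    rw [norm_mul, Complex.norm_real, Real.norm_of_nonneg (smoothedPow_nonneg _ _ _ _)]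
  rw [div_le_iff₀ (by positivity)]
  refine h2.trans ?_
  rw [add_mul, Finset.sum_mul]
  refine add_le_add (Finset.sum_le_sum fun j hj => ?_) (le_mul_of_one_le_right hM0 hVk)
  have h3 := smoothedPow_le j hr V' hV0
  rw [div_le_iff₀ (by positivity)] at h3
  rw [mul_assoc]
  refine mul_le_mul_of_nonneg_left (h3.trans ?_) (norm_nonneg _)
  exact mul_le_mul_of_nonneg_left
    (pow_le_pow_right₀ hV (by simpa [Nat.lt_succ_iff] using hj)) (by positivity)

theorem HasPoleExpansion.tendsto_smoothedSum (h : HasPoleExpansion A α k c Φ) {γ : ℝ}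
    (hγ : c k = γ) {r : ℝ} (hr : 0 < r) (w : ℝ) :
    Tendsto (fun V : ℝ => smoothedSum A (α + 1 / V) r (V + w) / V ^ k) atTop
      (𝓝 (γ / k.factorial * (Real.exp (-1) * ∫ u, fejer (r * u)))) := by
  set L : ℝ := Real.exp (-1) * ∫ u, fejer (r * u)
  have hterm : ∀ j ∈ Finset.range (k + 1), Tendsto (fun V : ℝ => (c j / j.factorial : ℂ) *
      ((smoothedPow j r (1 / V) (V + w) / V ^ k : ℝ) : ℂ)) atTop
      (𝓝 (if j = k then (c j / j.factorial : ℂ) * L else 0)) := by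
    intro j hj
    have hjk : j ≤ k := by simpa [Nat.lt_succ_iff] using hj
    have h1 := tendsto_smoothedPow j hr.ne' w
    split_ifs with hjk'
    · subst hjk'
      exact ((Complex.continuous_ofReal.tendsto _).comp h1).const_mul _
    · have hlt : 0 < k - j := by omega
      have h2 : Tendsto (fun V : ℝ => smoothedPow j r (1 / V) (V + w) / V ^ j / V ^ (k - j)) atTop
          (𝓝 0) := h1.div_atTop (tendsto_pow_atTop hlt.ne')
      have h3 := ((Complex.continuous_ofReal.tendsto _).comp h2).const_mul (c j / j.factorial : ℂ)
      rw [Complex.ofReal_zero, mul_zero] at h3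
      refine h3.congr fun V => ?_
      simp only [Function.comp]
      rw [div_div, ← pow_add, Nat.add_sub_cancel' hjk]
  have hsum := tendsto_finsetSum _ hterm
  rw [Finset.sum_ite_eq' (Finset.range (k + 1)) k, if_pos (by simp)] at hsum
  have hE : Tendsto (fun V : ℝ => smoothedRegular Φ (α + 1 / V) r (V + w) / (V ^ k : ℝ)) atTop
      (𝓝 0) := by
    have h1 := (tendsto_smoothedRegular h.continuousOn hr w).norm
    rw [norm_zero] at h1
    refine squeeze_zero_norm' ?_ h1
    filter_upwards [eventually_ge_atTop 1] with V hV
    have hVk : 1 ≤ V ^ k := one_le_pow₀ hV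
    rw [norm_div, Complex.norm_real, Real.norm_of_nonneg (by positivity)]
    exact div_le_self (norm_nonneg _) hVk
  have hadd := hsum.add hE
  have hre := (Complex.continuous_re.tendsto _).comp hadd
  have hlim : ((c k / k.factorial : ℂ) * L + 0).re = γ / k.factorial * L := by
    rw [hγ, add_zero, ← Complex.ofReal_natCast, ← Complex.ofReal_div, ← Complex.ofReal_mul,
      Complex.ofReal_re]
  rw [hlim] at hre
  refine hre.congr' ?_
  filter_upwards [eventually_ge_atTop 1] with V hV
  have h1 := h.smoothedSum_eq (ε := 1 / V) (by positivity) r (V + w)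
  simp only [Function.comp]
  rw [← Complex.ofReal_re (smoothedSum A (α + 1 / V) r (V + w) / V ^ k)]
  congr 1
  rw [Complex.ofReal_div, h1, add_div, Finset.sum_div]
  congr 1
  refine Finset.sum_congr rfl fun j _ => ?_
  push_cast
  ring

end PoleExpansion

section FejerAverage

open MeasureTheory Set Filter Topology

theorem integral_fejer_symm_pos {R : ℝ} (hR : 0 < R) : 0 < ∫ u in (-R)..R, fejer u := by
  refine intervalIntegral.integral_pos (by linarith) continuous_fejer.continuousOn
    (fun u _ => fejer_nonneg u) ⟨0, ⟨by linarith, hR.le⟩, ?_⟩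
  rw [fejer_zero]
  exact one_pos

theorem exp_mul_le_fejer_average {f : ℝ → ℝ} {Q : ℝ} (hQ : 0 ≤ Q) (hf0 : ∀ ρ, 0 ≤ f ρ)
    (hshift : ∀ ρ s, 0 ≤ s → Real.exp (-(Q * s)) * f ρ ≤ f (ρ + s)) {R h : ℝ} (hR : 0 < R)
    (hh : 0 < h) (ρ : ℝ) (hint : Integrable fun u => fejer u * f (ρ + h + u / (R / h))) :
    Real.exp (-(2 * Q * h)) * (∫ u in (-R)..R, fejer u) * f ρ ≤
      ∫ u, fejer u * f (ρ + h + u / (R / h)) := by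
  rw [mul_right_comm, ← intervalIntegral.integral_const_mul,
    intervalIntegral.integral_of_le (by linarith)]
  refine le_trans ?_ (setIntegral_le_integral (s := Ioc (-R) R) hint
    (Eventually.of_forall fun u => mul_nonneg (fejer_nonneg _) (hf0 _)))
  refine setIntegral_mono_on (integrable_fejer.const_mul _).integrableOn hint.integrableOn
    measurableSet_Ioc fun u hu => ?_
  rw [mul_comm]
  refine mul_le_mul_of_nonneg_left ?_ (fejer_nonneg _)
  have hu1 : -h ≤ u / (R / h) := by
    rw [le_div_iff₀ (by positivity)]; field_simp; exact hu.1.le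
  have hu2 : u / (R / h) ≤ h := by
    rw [div_le_iff₀ (by positivity)]; field_simp; exact hu.2
  rw [add_assoc]
  refine le_trans (mul_le_mul_of_nonneg_right (Real.exp_le_exp.2 ?_) (hf0 ρ))
    (hshift ρ (h + u / (R / h)) (by linarith))
  nlinarith

theorem fejer_average_le {f : ℝ → ℝ} {Q C : ℝ} (hQ : 0 ≤ Q) (hf0 : ∀ ρ, 0 ≤ f ρ)
    (hC : ∀ ρ, f ρ ≤ C)
    (hshift : ∀ ρ s, 0 ≤ s → Real.exp (-(Q * s)) * f ρ ≤ f (ρ + s)) {R h : ℝ} (hR : 0 < R)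
    (hh : 0 < h) (ρ : ℝ) (hint : Integrable fun u => fejer u * f (ρ - h + u / (R / h))) :
    ∫ u, fejer u * f (ρ - h + u / (R / h)) ≤ Real.exp (2 * Q * h) * (∫ u, fejer u) * f ρ +
      C * ((∫ u, fejer u) - ∫ u in (-R)..R, fejer u) := by
  have hpt : ∀ u, fejer u * f (ρ - h + u / (R / h)) ≤
      Real.exp (2 * Q * h) * f ρ * fejer u + C * (fejer u - (Ioc (-R) R).indicator fejer u) := by
    intro u
    by_cases hu : u ∈ Ioc (-R) R
    · rw [indicator_of_mem hu, sub_self, mul_zero, add_zero, mul_comm]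
      refine mul_le_mul_of_nonneg_right ?_ (fejer_nonneg _)
      have hu1 : -h ≤ u / (R / h) := by
        rw [le_div_iff₀ (by positivity)]; field_simp; exact hu.1.le
      have hu2 : u / (R / h) ≤ h := by
        rw [div_le_iff₀ (by positivity)]; field_simp; exact hu.2
      have h1 := hshift (ρ - h + u / (R / h)) (h - u / (R / h)) (by linarith)
      rw [show ρ - h + u / (R / h) + (h - u / (R / h)) = ρ by ring] at h1
      have h2 : f (ρ - h + u / (R / h)) ≤ Real.exp (Q * (h - u / (R / h))) * f ρ := by
        have h3 := mul_le_mul_of_nonneg_left h1 (Real.exp_pos (Q * (h - u / (R / h)))).le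
        rwa [← mul_assoc, ← Real.exp_add, add_neg_cancel, Real.exp_zero, one_mul] at h3
      refine h2.trans (mul_le_mul_of_nonneg_right (Real.exp_le_exp.2 ?_) (hf0 ρ))
      nlinarith
    · rw [indicator_of_notMem hu, sub_zero, mul_comm]
      have h1 := mul_le_mul_of_nonneg_right (hC (ρ - h + u / (R / h))) (fejer_nonneg u)
      have h2 : 0 ≤ Real.exp (2 * Q * h) * f ρ * fejer u :=
        mul_nonneg (mul_nonneg (Real.exp_pos _).le (hf0 ρ)) (fejer_nonneg u)
      linarith
  have hi := integrable_fejer.indicator (measurableSet_Ioc (a := -R) (b := R))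
  have hi' : Integrable fun u => C * (fejer u - (Ioc (-R) R).indicator fejer u) :=
    (integrable_fejer.sub hi).const_mul _
  have hi'' : Integrable fun u => Real.exp (2 * Q * h) * f ρ * fejer u :=
    integrable_fejer.const_mul _
  refine (integral_mono hint (hi''.add hi') hpt).trans_eq ?_
  simp only [Pi.add_apply]
  rw [integral_add hi'' hi', integral_const_mul, integral_const_mul,
    integral_sub integrable_fejer hi,
    integral_indicator measurableSet_Ioc, intervalIntegral.integral_of_le (by linarith)]
  ring

/-- A Tauberian principle: convergence of all Fejér averages of a family of nonnegative slowly
decreasing functions forces convergence of the family at a point. -/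
theorem tendsto_of_tendsto_fejer_average {F : ℝ → ℝ → ℝ} {Q L : ℝ} (hQ : 0 ≤ Q)
    (hF0 : ∀ V, 1 ≤ V → ∀ ρ, 0 ≤ F V ρ)
    (hint : ∀ V, 1 ≤ V → ∀ ρ r, 0 < r → Integrable fun u => fejer u * F V (ρ + u / r))
    (hshift : ∀ V, 1 ≤ V → ∀ ρ s, 0 ≤ s → Real.exp (-(Q * s)) * F V ρ ≤ F V (ρ + s))
    (hbd : ∃ C, ∀ V, 1 ≤ V → ∀ ρ, ∫ u, fejer u * F V (ρ + u / 1) ≤ C)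
    (hlim : ∀ ρ r, 0 < r → Tendsto (fun V => ∫ u, fejer u * F V (ρ + u / r)) atTop
      (𝓝 (L * ∫ u, fejer u))) :
    Tendsto (fun V => F V 0) atTop (𝓝 L) := by
  obtain ⟨C, hC⟩ := hbd
  set c := ∫ u, fejer u with hc
  have hcpos : 0 < c := integral_fejer_pos
  set p : ℝ → ℝ := fun R => ∫ u in (-R)..R, fejer u with hp
  have hppos : ∀ R, 0 < R → 0 < p R := fun R hR => integral_fejer_symm_pos hR
  have hplim : Tendsto p atTop (𝓝 c) :=
    intervalIntegral_tendsto_integral integrable_fejer tendsto_neg_atTop_atBot tendsto_id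
  have hbound : ∀ V, 1 ≤ V → ∀ ρ, F V ρ ≤ C / (Real.exp (-(2 * Q * 1)) * p 1) := by
    intro V hV ρ
    rw [le_div_iff₀ (mul_pos (Real.exp_pos _) (hppos 1 one_pos)), mul_comm]
    have h1 := exp_mul_le_fejer_average hQ (hF0 V hV) (hshift V hV) one_pos one_pos ρ
      (hint V hV _ _ (by norm_num))
    rw [div_one] at h1
    exact h1.trans (hC V hV _)
  set C₀ := C / (Real.exp (-(2 * Q * 1)) * p 1)
  have hexp : ∀ a : ℝ, Tendsto (fun R : ℝ => Real.exp (a * (1 / R))) atTop (𝓝 1) := by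
    intro a
    have h1 : Tendsto (fun R : ℝ => a * (1 / R)) atTop (𝓝 (a * 0)) := by
      simpa using (tendsto_inv_atTop_zero (𝕜 := ℝ)).const_mul a
    rw [mul_zero] at h1
    simpa [Function.comp_def] using (Real.continuous_exp.tendsto 0).comp h1
  refine tendsto_order.2 ⟨fun a ha => ?_, fun a ha => ?_⟩
  · have h1 : Tendsto (fun R : ℝ => a * (Real.exp (2 * Q * (1 / R)) * c) + C₀ * (c - p R)) atTop
        (𝓝 (a * (1 * c) + C₀ * (c - c))) :=
      (((hexp _).mul_const c).const_mul a).add ((hplim.const_sub c).const_mul C₀)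
    have h2 : a * (1 * c) + C₀ * (c - c) < L * c := by nlinarith
    obtain ⟨R, hR, hR0⟩ := ((h1.eventually (gt_mem_nhds h2)).and (eventually_gt_atTop 0)).exists
    filter_upwards [(hlim (0 - 1 / R) (R / (1 / R)) (by positivity)).eventually (lt_mem_nhds hR),
      eventually_ge_atTop 1] with V hV hV1
    have h3 := fejer_average_le hQ (hF0 V hV1) (hbound V hV1) (hshift V hV1) hR0
      (by positivity : 0 < 1 / R) 0 (hint V hV1 _ _ (by positivity))
    have h4 := hV.trans_le h3
    have h5 : a * (Real.exp (2 * Q * (1 / R)) * c) < F V 0 * (Real.exp (2 * Q * (1 / R)) * c) := by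
      simp only [hp, hc] at h4 ⊢
      linarith
    exact lt_of_mul_lt_mul_right h5 (mul_pos (Real.exp_pos _) hcpos).le
  · have h1 : Tendsto (fun R : ℝ => a * (Real.exp (-(2 * Q) * (1 / R)) * p R)) atTop
        (𝓝 (a * (1 * c))) := ((hexp _).mul hplim).const_mul a
    have h2 : L * c < a * (1 * c) := by nlinarith
    obtain ⟨R, hR, hR0⟩ := ((h1.eventually (lt_mem_nhds h2)).and (eventually_gt_atTop 0)).exists
    filter_upwards [(hlim (0 + 1 / R) (R / (1 / R)) (by positivity)).eventually (gt_mem_nhds hR),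
      eventually_ge_atTop 1] with V hV hV1
    have h3 := exp_mul_le_fejer_average hQ (hF0 V hV1) (hshift V hV1) hR0
      (by positivity : 0 < 1 / R) 0 (hint V hV1 _ _ (by positivity))
    have h4 := h3.trans_lt hV
    rw [show -(2 * Q * (1 / R)) = -(2 * Q) * (1 / R) by ring, mul_comm] at h4
    exact lt_of_mul_lt_mul_right h4 (mul_pos (Real.exp_pos _) (hppos R hR0)).le

end FejerAverage

section GumbelAverage

open MeasureTheory Set Filter Topology

/-- The density of the Gamma distribution on the logarithmic scale. -/
noncomputable def gumbel (q u : ℝ) : ℝ := Real.exp (q * u - Real.exp u)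

theorem gumbel_pos (q u : ℝ) : 0 < gumbel q u := Real.exp_pos _

theorem continuous_gumbel (q : ℝ) : Continuous (gumbel q) := by
  unfold gumbel
  fun_prop

theorem exp_neg_mul_gumbel_le (q u : ℝ) {s : ℝ} (hs : 0 ≤ s) :
    Real.exp (-(q * s)) * gumbel q u ≤ gumbel q (u - s) := by
  rw [gumbel, gumbel, ← Real.exp_add]
  have : Real.exp (u - s) ≤ Real.exp u := Real.exp_le_exp.2 (by linarith)
  exact Real.exp_le_exp.2 (by nlinarith)

theorem gumbel_le {q : ℝ} (hq : 0 < q) (u : ℝ) : gumbel q u ≤ Real.exp (q * Real.log q - q) := by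
  refine Real.exp_le_exp.2 ?_
  have h1 := Real.add_one_le_exp (u - Real.log q)
  rw [Real.exp_sub, Real.exp_log hq, le_div_iff₀ hq] at h1
  nlinarith

theorem gumbel_le_add {p q : ℝ} (h1 : p ≤ q) (h2 : q ≤ p + 1) (u : ℝ) :
    gumbel q u ≤ gumbel p u + gumbel (p + 1) u := by
  rcases le_total 0 u with hu | hu
  · refine le_add_of_nonneg_of_le (gumbel_pos _ _).le (Real.exp_le_exp.2 ?_)
    nlinarith
  · refine le_add_of_le_of_nonneg (Real.exp_le_exp.2 ?_) (gumbel_pos _ _).le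
    nlinarith

theorem exp_smul_gamma_integrand (q u : ℝ) :
    |Real.exp u| • (Real.exp (-Real.exp u) * Real.exp u ^ (q - 1)) = gumbel q u := by
  rw [abs_of_pos (Real.exp_pos u), smul_eq_mul, ← Real.exp_mul, ← Real.exp_add, ← Real.exp_add,
    gumbel]
  congr 1
  ring

theorem integrable_gumbel {q : ℝ} (hq : 0 < q) : Integrable (gumbel q) := by
  have h := (integrableOn_image_iff_integrableOn_abs_deriv_smul MeasurableSet.univ
    (fun u _ => (Real.hasDerivAt_exp u).hasDerivWithinAt) Real.exp_injective.injOn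
    (fun x => Real.exp (-x) * x ^ (q - 1))).1
      (by rw [image_univ, Real.range_exp]; exact Real.GammaIntegral_convergent hq)
  rw [integrableOn_univ] at h
  exact h.congr (Eventually.of_forall fun u => exp_smul_gamma_integrand q u)

theorem integral_gumbel {q : ℝ} (hq : 0 < q) : ∫ u, gumbel q u = Real.Gamma q := by
  have h := integral_image_eq_integral_abs_deriv_smul MeasurableSet.univ
    (fun u _ => (Real.hasDerivAt_exp u).hasDerivWithinAt) Real.exp_injective.injOn
    (fun x => Real.exp (-x) * x ^ (q - 1))
  rw [image_univ, Real.range_exp, ← Real.Gamma_eq_integral hq, setIntegral_univ] at h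
  rw [h]
  exact integral_congr_ae (Eventually.of_forall fun u => (exp_smul_gamma_integrand q u).symm)

/-- The Dirichlet series weighted by the kernel `gumbel q` centred at `X`. -/
noncomputable def gumbelSum (A : ℕ → ℝ) (σ q X : ℝ) : ℝ :=
  ∑' δ : ℕ, A δ * Real.exp (-(σ * Real.log (δ + 1))) * gumbel q (Real.log (δ + 1) - X)

variable {A : ℕ → ℝ} {α : ℝ} {k : ℕ} {c : ℕ → ℂ} {Φ : ℂ → ℂ}

theorem HasPoleExpansion.weight_nonneg (h : HasPoleExpansion A α k c Φ) (σ : ℝ) (δ : ℕ) :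
    0 ≤ A δ * Real.exp (-(σ * Real.log (δ + 1))) :=
  mul_nonneg (h.nonneg δ) (Real.exp_pos _).le

theorem HasPoleExpansion.gumbelSum_term_le (h : HasPoleExpansion A α k c Φ) (σ : ℝ) {q : ℝ}
    (hq : 0 < q) (X : ℝ) (δ : ℕ) :
    ‖A δ * Real.exp (-(σ * Real.log (δ + 1))) * gumbel q (Real.log (δ + 1) - X)‖ ≤
      A δ * Real.exp (-(σ * Real.log (δ + 1))) * Real.exp (q * Real.log q - q) := by
  rw [Real.norm_of_nonneg (mul_nonneg (h.weight_nonneg σ δ) (gumbel_pos _ _).le)]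
  exact mul_le_mul_of_nonneg_left (gumbel_le hq _) (h.weight_nonneg σ δ)

theorem HasPoleExpansion.summable_gumbelSum (h : HasPoleExpansion A α k c Φ) {σ q : ℝ}
    (hσ : α < σ) (hq : 0 < q) (X : ℝ) : Summable fun δ : ℕ =>
      A δ * Real.exp (-(σ * Real.log (δ + 1))) * gumbel q (Real.log (δ + 1) - X) :=
  ((h.summable σ hσ).mul_right _).of_norm_bounded fun δ => h.gumbelSum_term_le σ hq X δ

theorem HasPoleExpansion.gumbelSum_nonneg (h : HasPoleExpansion A α k c Φ) (σ q X : ℝ) :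
    0 ≤ gumbelSum A σ q X :=
  tsum_nonneg fun δ => mul_nonneg (h.weight_nonneg σ δ) (gumbel_pos _ _).le

theorem HasPoleExpansion.gumbelSum_le (h : HasPoleExpansion A α k c Φ) {σ q : ℝ}
    (hσ : α < σ) (hq : 0 < q) (X : ℝ) : gumbelSum A σ q X ≤
      ∑' δ : ℕ, A δ * Real.exp (-(σ * Real.log (δ + 1))) * Real.exp (q * Real.log q - q) :=
  (h.summable_gumbelSum hσ hq X).tsum_le_tsum
    (fun δ => (le_abs_self _).trans (h.gumbelSum_term_le σ hq X δ))
    ((h.summable σ hσ).mul_right _)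

theorem HasPoleExpansion.continuous_gumbelSum (h : HasPoleExpansion A α k c Φ) {σ q : ℝ}
    (hσ : α < σ) (hq : 0 < q) : Continuous (gumbelSum A σ q) := by
  have := continuous_gumbel q
  exact continuous_tsum (fun δ => by fun_prop) ((h.summable σ hσ).mul_right _)
    fun δ X => h.gumbelSum_term_le σ hq X δ

theorem HasPoleExpansion.exp_neg_mul_gumbelSum_le (h : HasPoleExpansion A α k c Φ) {σ q : ℝ}
    (hσ : α < σ) (hq : 0 < q) (X : ℝ) {s : ℝ} (hs : 0 ≤ s) :
    Real.exp (-(q * s)) * gumbelSum A σ q X ≤ gumbelSum A σ q (X + s) := by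
  rw [gumbelSum, ← tsum_mul_left]
  refine ((h.summable_gumbelSum hσ hq X).mul_left _).tsum_le_tsum (fun δ => ?_)
    (h.summable_gumbelSum hσ hq _)
  rw [mul_left_comm, ← sub_sub]
  exact mul_le_mul_of_nonneg_left (exp_neg_mul_gumbel_le q _ hs) (h.weight_nonneg σ δ)

theorem HasPoleExpansion.integrable_fejer_mul_gumbelSum (h : HasPoleExpansion A α k c Φ)
    {σ q : ℝ} (hσ : α < σ) (hq : 0 < q) (X r : ℝ) :
    Integrable fun u => fejer u * gumbelSum A σ q (X + u / r) := by
  have h1 := h.continuous_gumbelSum hσ hq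
  refine integrable_fejer.mul_bdd
    (c := ∑' δ : ℕ, A δ * Real.exp (-(σ * Real.log (δ + 1))) * Real.exp (q * Real.log q - q))
    ?_ (Eventually.of_forall fun u => ?_)
  · exact (by fun_prop : Continuous fun u => gumbelSum A σ q (X + u / r)).aestronglyMeasurable
  rw [Real.norm_of_nonneg (h.gumbelSum_nonneg _ _ _)]
  exact h.gumbelSum_le hσ hq _

theorem integral_fejer_mul_gumbel {q r : ℝ} (hr : 0 < r) (X ℓ : ℝ) :
    ∫ u, fejer u * gumbel q (ℓ - (X + u / r)) =
      r * ∫ v, gumbel q v * fejer (r * (X + v - ℓ)) := by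
  rw [← integral_sub_left_eq_self (fun v => gumbel q v * fejer (r * (X + v - ℓ))) _ (ℓ - X)]
  have h := Measure.integral_comp_div (fun s => gumbel q (ℓ - X - s) *
    fejer (r * (X + (ℓ - X - s) - ℓ))) r
  rw [abs_of_pos hr, smul_eq_mul] at h
  rw [← h]
  refine integral_congr_ae (Eventually.of_forall fun u => ?_)
  simp only
  rw [show r * (X + (ℓ - X - u / r) - ℓ) = -u by field_simp; ring, fejer_neg, mul_comm, sub_sub]

theorem HasPoleExpansion.integral_fejer_mul_gumbelSum (h : HasPoleExpansion A α k c Φ)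
    {σ q : ℝ} (hσ : α < σ) (hq : 0 < q) (X : ℝ) {r : ℝ} (hr : 0 < r) :
    ∫ u, fejer u * gumbelSum A σ q (X + u / r) =
      r * ∫ v, gumbel q v * smoothedSum A σ r (X + v) := by
  have hcg := continuous_gumbel q
  have hcf := continuous_fejer
  have hf : ∀ δ : ℕ, Integrable fun u => A δ * Real.exp (-(σ * Real.log (δ + 1))) *
      (fejer u * gumbel q (Real.log (δ + 1) - (X + u / r))) := fun δ => by
    refine Integrable.const_mul (integrable_fejer.mul_bdd
      (c := Real.exp (q * Real.log q - q)) ?_ (Eventually.of_forall fun u => ?_)) _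
    · exact (by fun_prop : Continuous fun u =>
        gumbel q (Real.log (δ + 1) - (X + u / r))).aestronglyMeasurable
    rw [Real.norm_of_nonneg (gumbel_pos _ _).le]
    exact gumbel_le hq _
  have hg : ∀ δ : ℕ, Integrable fun v => A δ * Real.exp (-(σ * Real.log (δ + 1))) *
      (gumbel q v * fejer (r * (X + v - Real.log (δ + 1)))) := fun δ => by
    refine Integrable.const_mul ((integrable_gumbel hq).mul_bdd (c := 2) ?_
      (Eventually.of_forall fun u => ?_)) _
    · exact (by fun_prop : Continuous fun v =>
        fejer (r * (X + v - Real.log (δ + 1)))).aestronglyMeasurable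
    rw [Real.norm_of_nonneg (fejer_nonneg _)]
    exact fejer_le_two _
  have hg_le : ∀ δ : ℕ, ∫ v, gumbel q v * fejer (r * (X + v - Real.log (δ + 1))) ≤
      (∫ v, gumbel q v) * 2 := fun δ => by
    rw [← integral_mul_const]
    refine integral_mono_of_nonneg (Eventually.of_forall fun v =>
      mul_nonneg (gumbel_pos _ _).le (fejer_nonneg _)) ((integrable_gumbel hq).mul_const 2)
      (Eventually.of_forall fun v =>
        mul_le_mul_of_nonneg_left (fejer_le_two _) (gumbel_pos _ _).le)
  have hg_nonneg : ∀ δ : ℕ, 0 ≤ ∫ v, gumbel q v * fejer (r * (X + v - Real.log (δ + 1))) :=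
    fun δ => integral_nonneg fun v => mul_nonneg (gumbel_pos _ _).le (fejer_nonneg _)
  have hsum : Summable fun δ : ℕ => A δ * Real.exp (-(σ * Real.log (δ + 1))) *
      ∫ v, gumbel q v * fejer (r * (X + v - Real.log (δ + 1))) :=
    ((h.summable σ hσ).mul_right ((∫ v, gumbel q v) * 2)).of_nonneg_of_le
      (fun δ => mul_nonneg (h.weight_nonneg σ δ) (hg_nonneg δ))
      (fun δ => mul_le_mul_of_nonneg_left (hg_le δ) (h.weight_nonneg σ δ))
  have h1 := hasSum_integral_of_summable_integral_norm hf (by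
    refine (hsum.mul_left r).congr fun δ => ?_
    simp_rw [Real.norm_of_nonneg (mul_nonneg (h.weight_nonneg σ δ)
      (mul_nonneg (fejer_nonneg _) (gumbel_pos _ _).le))]
    rw [integral_const_mul, integral_fejer_mul_gumbel hr]
    ring)
  have h2 := hasSum_integral_of_summable_integral_norm hg (by
    refine hsum.congr fun δ => ?_
    simp_rw [Real.norm_of_nonneg (mul_nonneg (h.weight_nonneg σ δ)
      (mul_nonneg (gumbel_pos _ _).le (fejer_nonneg _)))]
    rw [integral_const_mul])
  have h3 : ∀ u, fejer u * gumbelSum A σ q (X + u / r) = ∑' δ : ℕ, A δ *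
      Real.exp (-(σ * Real.log (δ + 1))) *
        (fejer u * gumbel q (Real.log (δ + 1) - (X + u / r))) := fun u => by
    rw [gumbelSum, ← tsum_mul_left]
    exact tsum_congr fun δ => by ring
  have h4 : ∀ v, gumbel q v * smoothedSum A σ r (X + v) = ∑' δ : ℕ, A δ *
      Real.exp (-(σ * Real.log (δ + 1))) *
        (gumbel q v * fejer (r * (X + v - Real.log (δ + 1)))) := fun v => by
    rw [smoothedSum, ← tsum_mul_left]
    exact tsum_congr fun δ => by ring
  simp_rw [h3, h4]
  rw [← h1.tsum_eq, ← h2.tsum_eq, ← tsum_mul_left]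
  refine tsum_congr fun δ => ?_
  rw [integral_const_mul, integral_const_mul, integral_fejer_mul_gumbel hr]
  ring

theorem HasPoleExpansion.continuous_smoothedSum (h : HasPoleExpansion A α k c Φ) {σ : ℝ}
    (hσ : α < σ) (r : ℝ) : Continuous (smoothedSum A σ r) := by
  have := continuous_fejer
  refine continuous_tsum (fun δ => by fun_prop) ((h.summable σ hσ).mul_right 2) fun δ V => ?_
  rw [Real.norm_of_nonneg (mul_nonneg (h.weight_nonneg σ δ) (fejer_nonneg _))]
  exact mul_le_mul_of_nonneg_left (fejer_le_two _) (h.weight_nonneg σ δ)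

theorem HasPoleExpansion.exists_integral_gumbel_mul_smoothedSum_le
    (h : HasPoleExpansion A α k c Φ) {p : ℝ} (hp : 0 < p) {r : ℝ} (hr : r ≠ 0) :
    ∃ C, ∀ V, 1 ≤ V → ∀ X,
      (∫ v, gumbel (p + 1 / V) v * smoothedSum A (α + 1 / V) r (X + v)) / V ^ k ≤ C := by
  obtain ⟨C, hC0, hC⟩ := h.exists_smoothedSum_le hr
  refine ⟨∫ v, (gumbel p v + gumbel (p + 1) v) * C, fun V hV X => ?_⟩
  have hV0 : 0 < V := by linarith
  have hV1 : 1 / V ≤ 1 := by rw [div_le_one hV0]; exact hV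
  have hV2 : 0 < 1 / V := by positivity
  rw [← integral_div]
  refine integral_mono_of_nonneg (Eventually.of_forall fun v => ?_)
    (((integrable_gumbel hp).add (integrable_gumbel (by linarith))).mul_const C)
    (Eventually.of_forall fun v => ?_)
  · exact div_nonneg (mul_nonneg (gumbel_pos _ _).le (h.smoothedSum_nonneg _ _ _)) (by positivity)
  · simp only [mul_div_assoc]
    exact mul_le_mul (gumbel_le_add (by linarith) (by linarith) v) (hC V hV _)
      (div_nonneg (h.smoothedSum_nonneg _ _ _) (by positivity))
      (add_pos (gumbel_pos _ _) (gumbel_pos _ _)).le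

theorem HasPoleExpansion.tendsto_integral_gumbel_mul_smoothedSum
    (h : HasPoleExpansion A α k c Φ) {γ : ℝ} (hγ : c k = γ) {p : ℝ} (hp : 0 < p) {r : ℝ}
    (hr : 0 < r) (ρ : ℝ) :
    Tendsto (fun V : ℝ =>
      (∫ v, gumbel (p + 1 / V) v * smoothedSum A (α + 1 / V) r (V + ρ + v)) / V ^ k) atTop
      (𝓝 (Real.Gamma p * (γ / k.factorial * (Real.exp (-1) * ∫ u, fejer (r * u))))) := by
  obtain ⟨C, hC0, hC⟩ := h.exists_smoothedSum_le hr.ne'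
  have hV1 : ∀ V : ℝ, 1 ≤ V → 0 < 1 / V ∧ 1 / V ≤ 1 := fun V hV =>
    ⟨by positivity, by rw [div_le_one (by linarith)]; exact hV⟩
  rw [← integral_gumbel hp, ← integral_mul_const]
  simp_rw [← integral_div]
  refine tendsto_integral_filter_of_dominated_convergence
    (fun v => (gumbel p v + gumbel (p + 1) v) * C) ?_ ?_
    (((integrable_gumbel hp).add (integrable_gumbel (by linarith))).mul_const C) ?_
  · filter_upwards [eventually_ge_atTop 1] with V hV
    have h1 := h.continuous_smoothedSum (σ := α + 1 / V) (by linarith [(hV1 V hV).1]) r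
    have h2 := continuous_gumbel (p + 1 / V)
    exact (by fun_prop : Continuous fun v => gumbel (p + 1 / V) v *
      smoothedSum A (α + 1 / V) r (V + ρ + v) / V ^ k).aestronglyMeasurable
  · filter_upwards [eventually_ge_atTop 1] with V hV
    refine Eventually.of_forall fun v => ?_
    rw [Real.norm_of_nonneg (div_nonneg (mul_nonneg (gumbel_pos _ _).le
      (h.smoothedSum_nonneg _ _ _)) (by positivity)), mul_div_assoc]
    exact mul_le_mul (gumbel_le_add (by linarith [(hV1 V hV).1]) (by linarith [(hV1 V hV).2]) v)
      (hC V hV _) (div_nonneg (h.smoothedSum_nonneg _ _ _) (by positivity))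
      (add_pos (gumbel_pos _ _) (gumbel_pos _ _)).le
  · refine Eventually.of_forall fun v => ?_
    have h1 := h.tendsto_smoothedSum hγ hr (ρ + v)
    have h2 : Tendsto (fun V : ℝ => gumbel (p + 1 / V) v) atTop (𝓝 (gumbel p v)) := by
      have h3 : Continuous fun q => gumbel q v := by unfold gumbel; fun_prop
      have h4 : Tendsto (fun V : ℝ => p + 1 / V) atTop (𝓝 (p + 0)) := by
        simpa using (tendsto_inv_atTop_zero (𝕜 := ℝ)).const_add p
      rw [add_zero] at h4
      exact (h3.tendsto p).comp h4
    refine (h2.mul h1).congr fun V => ?_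
    rw [mul_div_assoc, add_assoc]

/-- The exponential sum `∑ δ ^ β A δ e ^ (-δ u)`, over positive `δ`. -/
noncomputable def expSum (A : ℕ → ℝ) (β u : ℝ) : ℝ :=
  ∑' δ : ℕ, ((δ : ℝ) + 1) ^ β * A δ * Real.exp (-((δ : ℝ) + 1) * u)

theorem gumbelSum_eq_expSum (A : ℕ → ℝ) (σ β V : ℝ) :
    gumbelSum A σ (σ + β) V = Real.exp (-((σ + β) * V)) * expSum A β (Real.exp (-V)) := by
  rw [gumbelSum, expSum, ← tsum_mul_left]
  refine tsum_congr fun δ => ?_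
  have hN : (0 : ℝ) < δ + 1 := by positivity
  have h1 : Real.exp (Real.log (δ + 1) - V) = (δ + 1) * Real.exp (-V) := by
    rw [sub_eq_add_neg, Real.exp_add, Real.exp_log hN]
  rw [gumbel, h1, Real.rpow_def_of_pos hN, mul_assoc, ← Real.exp_add,
    mul_comm (Real.exp (Real.log _ * β)), mul_assoc, mul_left_comm, ← Real.exp_add,
    ← Real.exp_add]
  congr 2
  ring

/-- The asymptotic behaviour of `expSum` at `0` given a polar expansion of the Dirichlet series. -/
theorem HasPoleExpansion.tendsto_expSum (h : HasPoleExpansion A α k c Φ) {γ : ℝ}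
    (hγ : c k = γ) {β : ℝ} (hp : 0 < α + β) :
    Tendsto (fun V : ℝ => Real.exp (-((α + β) * V)) * expSum A β (Real.exp (-V)) / V ^ k) atTop
      (𝓝 (Real.Gamma (α + β) * (γ / k.factorial))) := by
  set p := α + β with hpdef
  have hV1 : ∀ V : ℝ, 1 ≤ V → 0 < 1 / V ∧ 1 / V ≤ 1 := fun V hV =>
    ⟨by positivity, by rw [div_le_one (by linarith)]; exact hV⟩
  have hσ : ∀ V : ℝ, 1 ≤ V → α < α + 1 / V := fun V hV => by linarith [(hV1 V hV).1]
  have hq : ∀ V : ℝ, 1 ≤ V → 0 < p + 1 / V := fun V hV => by linarith [(hV1 V hV).1]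
  have havg : ∀ V : ℝ, 1 ≤ V → ∀ ρ r, 0 < r →
      ∫ u, fejer u * (gumbelSum A (α + 1 / V) (p + 1 / V) (V + (ρ + u / r)) / V ^ k) =
        r * ((∫ v, gumbel (p + 1 / V) v * smoothedSum A (α + 1 / V) r (V + ρ + v)) / V ^ k) := by
    intro V hV ρ r hr
    simp_rw [← mul_div_assoc, ← add_assoc]
    rw [integral_div, h.integral_fejer_mul_gumbelSum (hσ V hV) (hq V hV) _ hr]
  have hmain : Tendsto (fun V : ℝ => gumbelSum A (α + 1 / V) (p + 1 / V) (V + 0) / V ^ k) atTop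
      (𝓝 (Real.Gamma p * (γ / k.factorial) * Real.exp (-1))) := by
    refine tendsto_of_tendsto_fejer_average (Q := p + 1)
      (F := fun V ρ => gumbelSum A (α + 1 / V) (p + 1 / V) (V + ρ) / V ^ k) (by linarith)
      ?_ ?_ ?_ ?_ ?_
    · intro V hV ρ
      exact div_nonneg (h.gumbelSum_nonneg _ _ _) (by positivity)
    · intro V hV ρ r _
      simp_rw [← mul_div_assoc, ← add_assoc]
      exact (h.integrable_fejer_mul_gumbelSum (hσ V hV) (hq V hV) (V + ρ) r).div_const _
    · intro V hV ρ s hs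
      rw [← mul_div_assoc, ← add_assoc]
      refine div_le_div_of_nonneg_right ?_ (by positivity)
      refine le_trans (mul_le_mul_of_nonneg_right (Real.exp_le_exp.2 ?_)
        (h.gumbelSum_nonneg _ _ _)) (h.exp_neg_mul_gumbelSum_le (hσ V hV) (hq V hV) (V + ρ) hs)
      have := (hV1 V hV).2
      nlinarith
    · obtain ⟨C, hC⟩ := h.exists_integral_gumbel_mul_smoothedSum_le hp one_ne_zero
      refine ⟨C, fun V hV ρ => ?_⟩
      rw [havg V hV ρ 1 one_pos, one_mul]
      exact hC V hV _
    · intro ρ r hr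
      have h1 := (h.tendsto_integral_gumbel_mul_smoothedSum hγ hp hr ρ).const_mul r
      have h2 : r * ∫ u, fejer (r * u) = ∫ u, fejer u := by
        rw [Measure.integral_comp_mul_left, abs_of_pos (inv_pos.2 hr), smul_eq_mul,
          mul_inv_cancel_left₀ hr.ne']
      rw [show r * (Real.Gamma p * (γ / k.factorial * (Real.exp (-1) * ∫ u, fejer (r * u)))) =
        Real.Gamma p * (γ / k.factorial) * Real.exp (-1) * (r * ∫ u, fejer (r * u)) by ring,
        h2] at h1
      refine h1.congr' ?_
      filter_upwards [eventually_ge_atTop 1] with V hV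
      rw [havg V hV ρ r hr]
  have h1 := hmain.const_mul (Real.exp 1)
  rw [mul_comm (Real.exp 1), mul_assoc _ (Real.exp (-1)), ← Real.exp_add, neg_add_cancel,
    Real.exp_zero, mul_one] at h1
  refine h1.congr' ?_
  filter_upwards [eventually_ge_atTop 1] with V hV
  have hV0 : V ≠ 0 := by positivity
  rw [add_zero, show p + 1 / V = α + 1 / V + β by rw [hpdef]; ring, gumbelSum_eq_expSum,
    show -((α + 1 / V + β) * V) = -(p * V) + -1 by rw [hpdef]; field_simp; ring, Real.exp_add,
    ← mul_div_assoc, ← mul_assoc, mul_left_comm (Real.exp 1), ← Real.exp_add, add_neg_cancel,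
    Real.exp_zero, mul_one]

end GumbelAverage

section GeneratingFunction

open Complex MeasureTheory Set Filter Topology

variable {A : ℕ → ℝ}

/-- The power series `∑ A δ z ^ δ`. -/
noncomputable def powSum (A : ℕ → ℝ) (z : ℂ) : ℂ := ∑' δ : ℕ, (A δ : ℂ) * z ^ δ

/-- The primitive of `powSum A` vanishing at the origin. -/
noncomputable def powPrimitive (A : ℕ → ℝ) (z : ℂ) : ℂ :=
  ∑' δ : ℕ, (A δ / ((δ : ℂ) + 1)) * z ^ (δ + 1)

theorem hasDerivAt_powPrimitive (h0 : ∀ δ, 0 ≤ A δ)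
    (hA : ∀ r : ℝ, 0 < r → r < 1 → Summable fun δ => A δ * r ^ δ) {z : ℂ} (hz : ‖z‖ < 1) :
    HasDerivAt (powPrimitive A) (powSum A z) z := by
  obtain ⟨r, hr, hr1⟩ := exists_between hz
  have hr0 : 0 < r := (norm_nonneg z).trans_lt hr
  refine hasDerivAt_tsum_of_isPreconnected (u := fun δ => A δ * r ^ δ) (t := Metric.ball 0 r)
    (g := fun δ z => (A δ / ((δ : ℂ) + 1)) * z ^ (δ + 1)) (g' := fun δ z => (A δ : ℂ) * z ^ δ)
    (hA r hr0 hr1) Metric.isOpen_ball (convex_ball 0 r).isPreconnected ?_ ?_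
    (Metric.mem_ball_self hr0) ?_ (by simpa using hr)
  · intro δ w _
    have h : ((δ : ℂ) + 1) ≠ 0 := Nat.cast_add_one_ne_zero δ
    refine ((hasDerivAt_pow (δ + 1) w).const_mul ((A δ : ℂ) / ((δ : ℂ) + 1))).congr_deriv ?_
    push_cast
    rw [← mul_assoc, div_mul_cancel₀ _ h]
  · intro δ w hw
    rw [norm_mul, norm_pow, Complex.norm_real, Real.norm_of_nonneg (h0 δ)]
    have := (mem_ball_zero_iff.1 hw).le
    gcongr
    exact h0 δ
  · simp

theorem hasFPowerSeriesOnBall_powSum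
    (hA : ∀ r : ℝ, 0 < r → r < 1 → Summable fun δ => A δ * r ^ δ) :
    HasFPowerSeriesAt (powSum A) (FormalMultilinearSeries.ofScalars ℂ fun δ => (A δ : ℂ)) 0 := by
  have hrad : 0 < (FormalMultilinearSeries.ofScalars ℂ fun δ => (A δ : ℂ)).radius := by
    refine lt_of_lt_of_le (b := ((1 / 2 : NNReal) : ENNReal)) (by simp) ?_
    refine FormalMultilinearSeries.le_radius_of_summable _ ?_
    refine (hA (1 / 2) (by norm_num) (by norm_num)).abs.congr fun δ => ?_
    rw [FormalMultilinearSeries.ofScalars_norm]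
    simp [abs_mul]
  refine ((FormalMultilinearSeries.hasFPowerSeriesOnBall _ hrad).hasFPowerSeriesAt).congr ?_
  refine Eventually.of_forall fun z => ?_
  rw [powSum, FormalMultilinearSeries.sum]
  refine tsum_congr fun δ => ?_
  simp [mul_comm]

theorem iteratedDeriv_powSum
    (hA : ∀ r : ℝ, 0 < r → r < 1 → Summable fun δ => A δ * r ^ δ) (k : ℕ) :
    iteratedDeriv k (powSum A) 0 = k.factorial * A k := by
  obtain ⟨r, hr⟩ := hasFPowerSeriesOnBall_powSum hA
  have := hr.factorial_smul (1 : ℂ) k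
  rw [← iteratedDeriv_eq_iteratedFDeriv] at this
  rw [← this]
  simp

theorem analyticAt_powSum
    (hA : ∀ r : ℝ, 0 < r → r < 1 → Summable fun δ => A δ * r ^ δ) :
    AnalyticAt ℂ (powSum A) 0 := (hasFPowerSeriesOnBall_powSum hA).analyticAt

theorem iteratedDeriv_cexp_powPrimitive (h0 : ∀ δ, 0 ≤ A δ)
    (hA : ∀ r : ℝ, 0 < r → r < 1 → Summable fun δ => A δ * r ^ δ) (y : ℝ) {h : ℕ → ℝ}
    (h_zero : h 0 = 1)
    (h_succ : ∀ n, h (n + 1) = ∑ k ∈ Finset.range (n + 1),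
      (n.choose k : ℝ) * (y * (A k * k.factorial)) * h (n - k)) (n : ℕ) :
    iteratedDeriv n (fun z => cexp (y * powPrimitive A z)) 0 = h n := by
  have hder : ∀ z : ℂ, ‖z‖ < 1 → HasDerivAt (fun z => cexp (y * powPrimitive A z))
      ((y * powSum A z) * cexp (y * powPrimitive A z)) z := fun z hz => by
    exact ((hasDerivAt_powPrimitive h0 hA hz).const_mul (y : ℂ)).cexp.congr_deriv (mul_comm _ _)
  have hball : Metric.ball (0 : ℂ) 1 ∈ 𝓝 (0 : ℂ) := Metric.ball_mem_nhds _ one_pos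
  have hev : deriv (fun z => cexp (y * powPrimitive A z)) =ᶠ[𝓝 0]
      fun z => (y * powSum A z) * cexp (y * powPrimitive A z) := by
    filter_upwards [hball] with z hz using (hder z (by simpa using hz)).deriv
  have han : AnalyticAt ℂ (fun z => cexp (y * powPrimitive A z)) 0 := by
    refine DifferentiableOn.analyticAt (s := Metric.ball 0 1) (fun z hz => ?_) hball
    exact (hder z (by simpa using hz)).differentiableAt.differentiableWithinAt
  induction n using Nat.strong_induction_on with
  | _ n ih =>
    cases n with
    | zero => simp [h_zero, powPrimitive]
    | succ n =>
      rw [iteratedDeriv_succ', hev.iteratedDeriv_eq n,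
        iteratedDeriv_fun_mul ((analyticAt_const.fun_mul (analyticAt_powSum hA)).contDiffAt)
          han.contDiffAt, h_succ]
      push_cast
      refine Finset.sum_congr rfl fun k _ => ?_
      rw [ih (n - k) (by omega), iteratedDeriv_const_mul_field, iteratedDeriv_powSum hA]
      ring

theorem coeff_eq_circleIntegral (h0 : ∀ δ, 0 ≤ A δ)
    (hA : ∀ r : ℝ, 0 < r → r < 1 → Summable fun δ => A δ * r ^ δ) (y : ℝ) {h : ℕ → ℝ}
    (h_zero : h 0 = 1)
    (h_succ : ∀ n, h (n + 1) = ∑ k ∈ Finset.range (n + 1),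
      (n.choose k : ℝ) * (y * (A k * k.factorial)) * h (n - k)) (n : ℕ) {t : ℝ} (ht : 0 < t) :
    ((2 * Real.pi * (h n / n.factorial) : ℝ) : ℂ) = Real.exp (n * t) *
      ∫ θ in (-Real.pi)..Real.pi, cexp (y * powPrimitive A (cexp (-t + θ * I)) - n * θ * I) := by
  have hR : 0 < Real.exp (-t) := Real.exp_pos _
  have hR1 : Real.exp (-t) < 1 := by simpa using ht
  have key := DifferentiableOn.circleIntegral_one_div_sub_center_pow_smul (c := 0)
    (f := fun z => cexp (y * powPrimitive A z)) hR n (fun z hz => by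
      have hz1 : ‖z‖ < 1 := (mem_closedBall_zero_iff.1 hz).trans_lt hR1
      exact (((hasDerivAt_powPrimitive h0 hA hz1).const_mul (y : ℂ)).cexp).differentiableAt
        |>.differentiableWithinAt)
  rw [iteratedDeriv_cexp_powPrimitive h0 hA y h_zero h_succ, circleIntegral] at key
  have hterm : ∀ θ : ℝ, deriv (circleMap 0 (Real.exp (-t))) θ •
      (1 / (circleMap 0 (Real.exp (-t)) θ - 0) ^ (n + 1)) •
        cexp (y * powPrimitive A (circleMap 0 (Real.exp (-t)) θ)) =
      (I * Real.exp (n * t)) *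
        cexp (y * powPrimitive A (cexp (-t + θ * I)) - n * θ * I) := fun θ => by
    have hz : circleMap 0 (Real.exp (-t)) θ = cexp (-t + θ * I) := by
      rw [circleMap_zero, Complex.exp_add]; push_cast; rfl
    rw [deriv_circleMap, hz, sub_zero]
    simp only [smul_eq_mul, pow_succ, ← Complex.exp_nat_mul]
    rw [Complex.exp_sub, Complex.ofReal_exp]
    have h1 : cexp (n * (-t + θ * I)) = (cexp ((n * t : ℝ) : ℂ))⁻¹ * cexp (n * θ * I) := by
      rw [← Complex.exp_neg, ← Complex.exp_add]; congr 1; push_cast; ring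
    rw [h1]
    field_simp
  have hper : Function.Periodic (fun θ : ℝ =>
      cexp (y * powPrimitive A (cexp (-t + θ * I)) - n * θ * I)) (2 * Real.pi) := fun θ => by
    have e1 : cexp (-t + ((θ + 2 * Real.pi : ℝ) : ℂ) * I) = cexp (-t + θ * I) := by
      rw [← Complex.exp_periodic (-t + θ * I)]; congr 1; push_cast; ring
    beta_reduce
    rw [e1, Complex.exp_sub, Complex.exp_sub]
    congr 1
    have := Complex.exp_periodic.nat_mul n (n * θ * I)
    rw [← this]; congr 1; push_cast; ring
  simp only [hterm] at key
  rw [intervalIntegral.integral_const_mul] at key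
  have hshift := hper.intervalIntegral_add_eq 0 (-Real.pi)
  rw [zero_add, show -Real.pi + 2 * Real.pi = Real.pi by ring] at hshift
  rw [hshift] at key
  have hI : (I : ℂ) ≠ 0 := Complex.I_ne_zero
  rw [mul_assoc] at key
  have key2 := congrArg (fun w => I⁻¹ * w) key
  beta_reduce at key2
  rw [← mul_assoc, inv_mul_cancel₀ hI, one_mul] at key2
  rw [key2, smul_eq_mul]
  push_cast
  field_simp

end GeneratingFunction

section CharacteristicExponent

open Complex MeasureTheory Set Filter Topology

variable {A : ℕ → ℝ}

/-- The exponent of the characteristic function of the measure with masses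
`A δ e ^ {-(δ + 1) t} / (δ + 1)` at the points `δ + 1`. -/
noncomputable def charExp (A : ℕ → ℝ) (t θ : ℝ) : ℂ :=
  ∑' δ : ℕ, ((((δ : ℝ) + 1) ^ (-1 : ℝ) * A δ * Real.exp (-((δ : ℝ) + 1) * t) : ℝ) : ℂ) *
    (cexp ((((δ : ℝ) + 1) * θ : ℝ) * I) - 1)

/-- Summability of all the series `expSum A β t` with `t > 0`. -/
def ExpSummable (A : ℕ → ℝ) : Prop :=
  ∀ β t : ℝ, 0 < t → Summable fun δ : ℕ => ((δ : ℝ) + 1) ^ β * A δ * Real.exp (-((δ : ℝ) + 1) * t)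

theorem ExpSummable.summable_mul_pow (hS : ExpSummable A) {r : ℝ} (hr : 0 < r) (hr1 : r < 1) :
    Summable fun δ => A δ * r ^ δ := by
  have := (hS 0 (-Real.log r) (by have := Real.log_neg hr hr1; linarith)).mul_left r⁻¹
  refine this.congr fun δ => ?_
  rw [show -((δ : ℝ) + 1) * -Real.log r = ((δ + 1 : ℕ) : ℝ) * Real.log r by push_cast; ring,
    Real.exp_nat_mul, Real.exp_log hr, Real.rpow_zero, pow_succ]
  field_simp

theorem norm_cexp_mul_I_sub_one_le (u : ℝ) : ‖cexp (u * I) - 1‖ ≤ 2 := by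
  refine (norm_sub_le _ _).trans ?_
  rw [Complex.norm_exp_ofReal_mul_I, norm_one]
  norm_num

theorem ExpSummable.summable_charExp (hS : ExpSummable A) {t : ℝ} (ht : 0 < t) (θ : ℝ) :
    Summable fun δ : ℕ =>
      ((((δ : ℝ) + 1) ^ (-1 : ℝ) * A δ * Real.exp (-((δ : ℝ) + 1) * t) : ℝ) : ℂ) *
        (cexp ((((δ : ℝ) + 1) * θ : ℝ) * I) - 1) := by
  refine Summable.of_norm_bounded ((hS (-1) t ht).norm.mul_right 2) fun δ => ?_
  rw [norm_mul, Complex.norm_real]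
  exact mul_le_mul_of_nonneg_left (norm_cexp_mul_I_sub_one_le _) (norm_nonneg _)

theorem powPrimitive_cexp (hS : ExpSummable A) {t : ℝ} (ht : 0 < t) (θ : ℝ) :
    powPrimitive A (cexp (-t + θ * I)) = expSum A (-1) t + charExp A t θ := by
  rw [expSum, charExp, Complex.ofReal_tsum,
    ← ((Complex.hasSum_ofReal.2 (hS (-1) t ht).hasSum).summable).tsum_add
      (hS.summable_charExp ht θ),
    powPrimitive]
  refine tsum_congr fun δ => ?_
  rw [← Complex.exp_nat_mul, mul_sub, mul_one, add_sub_cancel, Real.rpow_neg_one]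
  have : cexp (((δ + 1 : ℕ) : ℂ) * (-t + θ * I)) =
      (Real.exp (-((δ : ℝ) + 1) * t) : ℂ) * cexp ((((δ : ℝ) + 1) * θ : ℝ) * I) := by
    rw [Complex.ofReal_exp, ← Complex.exp_add]; congr 1; push_cast; ring
  rw [this]
  push_cast
  ring

theorem continuous_charExp (hS : ExpSummable A) {t : ℝ} (ht : 0 < t) :
    Continuous (charExp A t) := by
  refine continuous_tsum (fun δ => by fun_prop) ((hS (-1) t ht).norm.mul_right 2) fun δ θ => ?_
  rw [norm_mul, Complex.norm_real]
  exact mul_le_mul_of_nonneg_left (norm_cexp_mul_I_sub_one_le _) (norm_nonneg _)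

theorem norm_cexp_mul_I_sub_taylor_le (u : ℝ) :
    ‖cexp (u * I) - 1 - (I * u - u ^ 2 / 2)‖ ≤ 4 * |u| ^ 3 := by
  rcases le_total |u| 1 with h | h
  · have := Complex.exp_bound (x := u * I) (by simpa using h) (n := 3) (by norm_num)
    simp only [Finset.sum_range_succ, Finset.sum_range_zero, norm_mul, Complex.norm_real,
      Complex.norm_I, mul_one, Real.norm_eq_abs] at this
    refine (le_of_eq ?_).trans (this.trans ?_)
    · congr 1
      simp only [Nat.factorial, mul_pow, Complex.I_sq]
      push_cast
      ring
    · rw [mul_comm]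
      gcongr
      norm_num [Nat.factorial]
  · have h1 : ‖I * (u : ℂ) - (u : ℂ) ^ 2 / 2‖ ≤ |u| + |u| ^ 2 / 2 := by
      refine (norm_sub_le _ _).trans (le_of_eq ?_)
      simp
    have h2 := norm_sub_le (cexp (u * I) - 1) (I * (u : ℂ) - (u : ℂ) ^ 2 / 2)
    have h3 := norm_cexp_mul_I_sub_one_le u
    have h4 : |u| ≤ |u| ^ 3 := le_self_pow₀ h (by norm_num)
    have h5 : |u| ^ 2 ≤ |u| ^ 3 := pow_le_pow_right₀ h (by norm_num)
    linarith

theorem norm_charExp_sub_le (h0 : ∀ δ, 0 ≤ A δ) (hS : ExpSummable A) {t : ℝ} (ht : 0 < t) (θ : ℝ) :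
    ‖charExp A t θ - (I * θ * expSum A 0 t - θ ^ 2 / 2 * expSum A 1 t)‖ ≤
      4 * |θ| ^ 3 * expSum A 2 t := by
  have hs : ∀ β : ℝ, Summable fun δ : ℕ =>
      ((((δ : ℝ) + 1) ^ β * A δ * Real.exp (-((δ : ℝ) + 1) * t) : ℝ) : ℂ) := fun β =>
    (Complex.hasSum_ofReal.2 (hS β t ht).hasSum).summable
  rw [expSum, expSum, expSum, charExp, Complex.ofReal_tsum, Complex.ofReal_tsum, ← tsum_mul_left,
    ← tsum_mul_left, ← tsum_mul_left, ← ((hs 0).mul_left _).tsum_sub ((hs 1).mul_left _),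
    ← (hS.summable_charExp ht θ).tsum_sub (((hs 0).mul_left _).sub ((hs 1).mul_left _))]
  refine tsum_of_norm_bounded ((hS 2 t ht).mul_left _).hasSum fun δ => ?_
  have hN : (0 : ℝ) < (δ : ℝ) + 1 := by positivity
  have key := norm_cexp_mul_I_sub_taylor_le (((δ : ℝ) + 1) * θ)
  have hw : 0 ≤ ((δ : ℝ) + 1) ^ (-1 : ℝ) * A δ * Real.exp (-((δ : ℝ) + 1) * t) := by
    have := h0 δ; positivity
  have e2 : ((δ : ℝ) + 1) ^ (2 : ℝ) = ((δ : ℝ) + 1) ^ 2 := by norm_cast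
  calc _ = ‖((((δ : ℝ) + 1) ^ (-1 : ℝ) * A δ * Real.exp (-((δ : ℝ) + 1) * t) : ℝ) : ℂ) *
        (cexp ((((δ : ℝ) + 1) * θ : ℝ) * I) - 1 -
          (I * (((δ : ℝ) + 1) * θ : ℝ) - (((δ : ℝ) + 1) * θ : ℝ) ^ 2 / 2))‖ := by
        congr 1
        rw [Real.rpow_neg_one, Real.rpow_zero, Real.rpow_one]
        have : ((δ : ℂ) + 1) ≠ 0 := Nat.cast_add_one_ne_zero δ
        push_cast
        field_simp
    _ ≤ ((δ : ℝ) + 1) ^ (-1 : ℝ) * A δ * Real.exp (-((δ : ℝ) + 1) * t) *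
        (4 * |((δ : ℝ) + 1) * θ| ^ 3) := by
        rw [norm_mul, Complex.norm_real, Real.norm_of_nonneg hw]
        exact mul_le_mul_of_nonneg_left key hw
    _ = _ := by
        rw [abs_mul, abs_of_pos hN, Real.rpow_neg_one, e2]
        field_simp

theorem re_charExp (hS : ExpSummable A) {t : ℝ} (ht : 0 < t) (θ : ℝ) :
    (charExp A t θ).re = ∑' δ : ℕ, ((δ : ℝ) + 1) ^ (-1 : ℝ) * A δ *
      Real.exp (-((δ : ℝ) + 1) * t) * (Real.cos (((δ : ℝ) + 1) * θ) - 1) := by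
  rw [charExp, Complex.re_tsum (hS.summable_charExp ht θ)]
  refine tsum_congr fun δ => ?_
  rw [Complex.re_ofReal_mul, Complex.sub_re, Complex.exp_ofReal_mul_I_re, Complex.one_re]

theorem re_charExp_le_near (h0 : ∀ δ, 0 ≤ A δ) (hS : ExpSummable A) {t C : ℝ} (ht : 0 < t)
    (hC : 0 < C) (hW : expSum A 2 t * t ≤ C * expSum A 1 t) {θ : ℝ} (hθ : |θ| ≤ (16 * C)⁻¹ * t) :
    (charExp A t θ).re ≤ -(θ ^ 2 * expSum A 1 t / 4) := by
  have h1 := (Complex.re_le_norm _).trans (norm_charExp_sub_le h0 hS ht θ)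
  have h2 : (I * θ * expSum A 0 t - θ ^ 2 / 2 * expSum A 1 t : ℂ).re =
      -(θ ^ 2 / 2 * expSum A 1 t) := by
    rw [show (I * θ * expSum A 0 t - θ ^ 2 / 2 * expSum A 1 t : ℂ) =
      ((-(θ ^ 2 / 2 * expSum A 1 t) : ℝ) : ℂ) + ((θ * expSum A 0 t : ℝ) : ℂ) * I by push_cast; ring]
    rw [Complex.add_re, Complex.re_ofReal_mul, Complex.I_re, Complex.ofReal_re, mul_zero, add_zero]
  rw [Complex.sub_re, h2] at h1
  have hW2 : 0 ≤ expSum A 2 t := tsum_nonneg fun δ => by have := h0 δ; positivity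
  have h3 : |θ| ^ 3 * expSum A 2 t ≤ θ ^ 2 * (expSum A 1 t / 16) := by
    rw [pow_succ, sq_abs, mul_assoc]
    refine mul_le_mul_of_nonneg_left ?_ (sq_nonneg θ)
    calc |θ| * expSum A 2 t ≤ (16 * C)⁻¹ * t * expSum A 2 t := by gcongr
      _ = (16 * C)⁻¹ * (expSum A 2 t * t) := by ring
      _ ≤ (16 * C)⁻¹ * (C * expSum A 1 t) := by gcongr
      _ = _ := by field_simp
  nlinarith

theorem tsum_exp_mul_one_sub_cos_ge {t : ℝ} (ht : 0 < t) (θ : ℝ) :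
    let q := Real.exp (-t)
    (Summable fun δ : ℕ => Real.exp (-((δ : ℝ) + 1) * t) * (1 - Real.cos (((δ : ℝ) + 1) * θ))) ∧
    q / (1 - q) - q / ‖(1 : ℂ) - q * cexp (θ * I)‖ ≤
      ∑' δ : ℕ, Real.exp (-((δ : ℝ) + 1) * t) * (1 - Real.cos (((δ : ℝ) + 1) * θ)) := by
  intro q
  have hq : 0 < q := Real.exp_pos _
  have hq1 : q < 1 := by simpa [q] using ht
  have hz : ‖(q : ℂ) * cexp (θ * I)‖ = q := by
    rw [norm_mul, Complex.norm_exp_ofReal_mul_I, mul_one, Complex.norm_real,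
      Real.norm_of_nonneg hq.le]
  have s1 := (hasSum_geometric_of_lt_one hq.le hq1).mul_left q
  have s2 := (hasSum_geometric_of_norm_lt_one (hz.trans_lt hq1)).mul_left ((q : ℂ) * cexp (θ * I))
  have s3 := s1.sub (Complex.hasSum_re s2)
  have e : ∀ δ : ℕ, q * q ^ δ - ((q : ℂ) * cexp (θ * I) * ((q : ℂ) * cexp (θ * I)) ^ δ).re =
      Real.exp (-((δ : ℝ) + 1) * t) * (1 - Real.cos (((δ : ℝ) + 1) * θ)) := fun δ => by
    have e1 : Real.exp (-((δ : ℝ) + 1) * t) = q * q ^ δ := by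
      rw [← pow_succ', ← Real.exp_nat_mul]; congr 1; push_cast; ring
    have e2 : (q : ℂ) * cexp (θ * I) * ((q : ℂ) * cexp (θ * I)) ^ δ =
        ((q * q ^ δ : ℝ) : ℂ) * cexp ((((δ : ℝ) + 1) * θ : ℝ) * I) := by
      have e3 : cexp ((((δ : ℝ) + 1) * θ : ℝ) * I) = cexp (θ * I) ^ (δ + 1) := by
        rw [← Complex.exp_nat_mul]; congr 1; push_cast; ring
      rw [e3]; push_cast; ring
    rw [e1, e2, Complex.re_ofReal_mul, Complex.exp_ofReal_mul_I_re]
    ring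
  simp only [e] at s3
  refine ⟨s3.summable, ?_⟩
  rw [s3.tsum_eq, ← div_eq_mul_inv, ← div_eq_mul_inv]
  gcongr
  refine (Complex.re_le_norm _).trans (le_of_eq ?_)
  rw [norm_div, hz]

theorem exists_re_charExp_le_far {c η : ℝ} (hc : 0 < c) (hη : 0 < η)
    (hA : ∀ δ : ℕ, c * ((δ : ℝ) + 1) ≤ A δ) (hS : ExpSummable A) :
    ∃ κ > 0, ∀ t : ℝ, 0 < t → t ≤ 1 → ∀ θ : ℝ, η * t ≤ |θ| → |θ| ≤ Real.pi →
      (charExp A t θ).re ≤ -(κ / t) := by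
  set ρ := Real.sqrt (1 + η ^ 2 / 10) with hρ
  have hρ1 : 1 < ρ := by
    rw [hρ, Real.lt_sqrt (by norm_num)]
    have := sq_pos_of_pos hη
    linarith
  have hρ0 : 0 < ρ := one_pos.trans hρ1
  refine ⟨c * ((1 - ρ⁻¹) / 3), by
    have := inv_lt_one_of_one_lt₀ hρ1
    have : 0 < 1 - ρ⁻¹ := by linarith
    positivity, fun t ht ht1 θ h1 h2 => ?_⟩
  obtain ⟨hs, hge⟩ := tsum_exp_mul_one_sub_cos_ge ht θ
  set q := Real.exp (-t) with hqdef
  have hq : 0 < q := Real.exp_pos _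
  have hq1 : q < 1 := by simpa [q] using ht
  have hqt : 1 - q ≤ t := by have := Real.add_one_le_exp (-t); linarith
  have hq3 : 1 / 3 ≤ q := by
    have h := Real.exp_one_lt_d9
    have h' : Real.exp (-1) ≤ q := Real.exp_le_exp.2 (by linarith)
    refine le_trans ?_ h'
    rw [Real.exp_neg, one_div]
    exact inv_anti₀ (Real.exp_pos 1) (by linarith)
  have hnorm : (1 - q) * ρ ≤ ‖(1 : ℂ) - q * cexp (θ * I)‖ := by
    have e : ‖(1 : ℂ) - q * cexp (θ * I)‖ ^ 2 = (1 - q) ^ 2 + 2 * q * (1 - Real.cos θ) := by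
      rw [Complex.sq_norm, Complex.normSq_apply]
      simp only [Complex.sub_re, Complex.sub_im, Complex.one_re, Complex.one_im,
        Complex.re_ofReal_mul, Complex.im_ofReal_mul, Complex.exp_ofReal_mul_I_re,
        Complex.exp_ofReal_mul_I_im]
      have := Real.sin_sq_add_cos_sq θ
      linear_combination q ^ 2 * this
    refine le_of_sq_le_sq ?_ (norm_nonneg _)
    rw [e, mul_pow, hρ, Real.sq_sqrt (by positivity)]
    have hcos := Real.cos_le_one_sub_mul_cos_sq (x := θ) h2
    have hθ : η * (1 - q) ≤ |θ| := le_trans (by gcongr) h1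
    have hθ2 : (η * (1 - q)) ^ 2 ≤ θ ^ 2 := by
      rw [← sq_abs θ]
      have : 0 ≤ η * (1 - q) := mul_nonneg hη.le (by linarith)
      gcongr
    have hpi : 2 / Real.pi ^ 2 ≥ 1 / 5 := by
      rw [ge_iff_le, div_le_div_iff₀ (by norm_num) (by positivity)]
      nlinarith [Real.pi_lt_d2, Real.pi_pos]
    have h3 : θ ^ 2 / 5 ≤ 1 - Real.cos θ := by nlinarith [sq_nonneg θ]
    have h4 : 1 / 3 * (θ ^ 2 / 5) ≤ q * (1 - Real.cos θ) := by gcongr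
    have h5 := sq_nonneg (η * (1 - q))
    linear_combination 2 * h4 + 2 / 15 * hθ2 + 1 / 30 * h5
  have hS1 : (1 - ρ⁻¹) / 3 / t ≤
      ∑' δ : ℕ, Real.exp (-((δ : ℝ) + 1) * t) * (1 - Real.cos (((δ : ℝ) + 1) * θ)) := by
    have hq1' : 0 < 1 - q := by linarith
    have hρi : 0 < 1 - ρ⁻¹ := by
      have := inv_lt_one_of_one_lt₀ hρ1
      linarith
    calc (1 - ρ⁻¹) / 3 / t = 1 / 3 / t * (1 - ρ⁻¹) := by ring
      _ ≤ q / (1 - q) * (1 - ρ⁻¹) := by gcongr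
      _ = q / (1 - q) - q / ((1 - q) * ρ) := by field_simp
      _ ≤ q / (1 - q) - q / ‖(1 : ℂ) - q * cexp (θ * I)‖ := by gcongr
      _ ≤ _ := hge
  have hsumm : Summable fun δ : ℕ => ((δ : ℝ) + 1) ^ (-1 : ℝ) * A δ *
      Real.exp (-((δ : ℝ) + 1) * t) * (Real.cos (((δ : ℝ) + 1) * θ) - 1) := by
    have := Complex.hasSum_re (hS.summable_charExp ht θ).hasSum
    refine this.summable.congr fun δ => ?_
    rw [Complex.re_ofReal_mul, Complex.sub_re, Complex.exp_ofReal_mul_I_re, Complex.one_re]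
  calc (charExp A t θ).re ≤ ∑' δ : ℕ,
        -c * (Real.exp (-((δ : ℝ) + 1) * t) * (1 - Real.cos (((δ : ℝ) + 1) * θ))) := by
        rw [re_charExp hS ht]
        refine hsumm.tsum_le_tsum (fun δ => ?_) (hs.mul_left _)
        have hN : (0 : ℝ) < (δ : ℝ) + 1 := by positivity
        have h6 : c ≤ ((δ : ℝ) + 1) ^ (-1 : ℝ) * A δ := by
          rw [Real.rpow_neg_one, ← div_eq_inv_mul, le_div_iff₀ hN]
          exact hA δ
        have h7 : 0 ≤ Real.exp (-((δ : ℝ) + 1) * t) * (1 - Real.cos (((δ : ℝ) + 1) * θ)) :=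
          mul_nonneg (Real.exp_pos _).le (by linarith [Real.cos_le_one (((δ : ℝ) + 1) * θ)])
        linear_combination mul_le_mul_of_nonneg_right h6 h7
    _ ≤ -(c * ((1 - ρ⁻¹) / 3) / t) := by
        rw [tsum_mul_left]
        linear_combination c * hS1

end CharacteristicExponent

section LocalLimit

open Complex MeasureTheory Set Filter Topology

variable {A : ℕ → ℝ}

theorem integral_cexp_linear_sub_sq (ξ : ℝ) :
    ∫ v : ℝ, cexp (I * ξ * v - v ^ 2 / 2) =
      (2 * Real.pi : ℂ) ^ (1 / 2 : ℂ) * cexp (-(ξ ^ 2 / 2)) := by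
  have := integral_cexp_quadratic (b := -(1 / 2)) (by norm_num) (I * ξ) 0
  rw [show (Real.pi : ℂ) / -(-(1 / 2)) = 2 * Real.pi by ring,
    show (0 : ℂ) - (I * ξ) ^ 2 / (4 * -(1 / 2)) = -(ξ ^ 2 / 2) by
      rw [mul_pow, Complex.I_sq]; ring] at this
  rw [← this]
  congr 1
  ext v
  congr 1
  ring

theorem expSum_nonneg (h0 : ∀ δ, 0 ≤ A δ) (β t : ℝ) : 0 ≤ expSum A β t :=
  tsum_nonneg fun δ => by have := h0 δ; positivity

theorem integrable_gaussian_add_inv :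
    Integrable fun v : ℝ => Real.exp (-(1 / 8) * v ^ 2) + (1 + v ^ 2)⁻¹ :=
  (integrable_exp_neg_mul_sq (by norm_num)).add integrable_inv_one_add_sq

theorem norm_cexp_charExp (A : ℕ → ℝ) (y t θ p : ℝ) :
    ‖cexp (y * charExp A t θ - p * θ * I)‖ = Real.exp (y * (charExp A t θ).re) := by
  rw [Complex.norm_exp]
  congr 1
  rw [Complex.sub_re, Complex.re_ofReal_mul, show (p * θ * I : ℂ) = ((p * θ : ℝ) : ℂ) * I by
    push_cast; rfl, Complex.re_ofReal_mul, Complex.I_re, mul_zero, sub_zero]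

/-- The local limit theorem for the coefficients of the exponential of a power series. -/
theorem tendsto_local_limit {c C x ξ : ℝ} (hc : 0 < c) (hA : ∀ δ : ℕ, c * ((δ : ℝ) + 1) ≤ A δ)
    (hS : ExpSummable A) (hC : 0 < C) (hx : 0 < x) {t y σ : ℕ → ℝ}
    (ht : Tendsto t atTop (𝓝[>] 0)) (hy : Tendsto y atTop (𝓝 x)) (hσ0 : ∀ᶠ n in atTop, 0 < σ n)
    (hσ : ∀ᶠ n in atTop, σ n ^ 2 = x * expSum A 1 (t n))
    (htσ : Tendsto (fun n => t n * σ n) atTop atTop)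
    (hW : ∀ᶠ n in atTop, expSum A 2 (t n) * t n ≤ C * expSum A 1 (t n))
    (hκ : ∀ κ > 0, Tendsto (fun n => Real.exp (-(κ / t n)) * σ n ^ 2) atTop (𝓝 0))
    (hξ : Tendsto (fun n => (y n * expSum A 0 (t n) - n) / σ n) atTop (𝓝 ξ)) :
    Tendsto (fun n => (σ n : ℂ) * ∫ θ in (-Real.pi)..Real.pi,
      cexp (y n * charExp A (t n) θ - n * θ * I)) atTop
      (𝓝 ((2 * Real.pi : ℂ) ^ (1 / 2 : ℂ) * cexp (-(ξ ^ 2 / 2)))) := by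
  have h0 : ∀ δ, 0 ≤ A δ := fun δ => le_trans (by positivity) (hA δ)
  have ht0 : ∀ᶠ n in atTop, 0 < t n := (tendsto_nhdsWithin_iff.1 ht).2
  have ht00 : Tendsto t atTop (𝓝 0) := (tendsto_nhdsWithin_iff.1 ht).1
  have ht1 : ∀ᶠ n in atTop, t n ≤ 1 := ht00.eventually_le_const one_pos
  have hσt : Tendsto σ atTop atTop := by
    refine tendsto_atTop_mono' _ ?_ htσ
    filter_upwards [ht1, hσ0] with n h1 h2
    nlinarith
  set F : ℕ → ℝ → ℂ := fun n v => (Ioc (-Real.pi * σ n) (Real.pi * σ n)).indicator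
    (fun v => cexp (y n * charExp A (t n) (v / σ n) - n * (v / σ n) * I)) v with hF
  have hint : ∀ᶠ n in atTop, (∫ v, F n v) = (σ n : ℂ) * ∫ θ in (-Real.pi)..Real.pi,
      cexp (y n * charExp A (t n) θ - n * θ * I) := by
    filter_upwards [hσ0] with n hn
    have hle : -Real.pi * σ n ≤ Real.pi * σ n := by nlinarith [Real.pi_pos]
    rw [hF, integral_indicator measurableSet_Ioc, ← intervalIntegral.integral_of_le hle]
    have := intervalIntegral.integral_comp_div (a := -Real.pi * σ n) (b := Real.pi * σ n)
      (fun θ : ℝ => cexp (y n * charExp A (t n) θ - n * θ * I)) hn.ne'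
    rw [mul_div_cancel_right₀ _ hn.ne', mul_div_cancel_right₀ _ hn.ne'] at this
    rw [← Complex.real_smul, ← this]
    simp only [Complex.ofReal_div]
  refine Tendsto.congr' hint ?_
  rw [← integral_cexp_linear_sub_sq]
  obtain ⟨κ, hκ0, hfar⟩ := exists_re_charExp_le_far hc (η := (16 * C)⁻¹) (by positivity) hA hS
  refine tendsto_integral_filter_of_dominated_convergence
    (fun v => Real.exp (-(1 / 8) * v ^ 2) + (1 + v ^ 2)⁻¹) ?_ ?_ integrable_gaussian_add_inv ?_
  · filter_upwards [ht0] with n hn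
    refine (Continuous.aestronglyMeasurable ?_).indicator measurableSet_Ioc
    have := continuous_charExp hS hn
    fun_prop
  · have hK : Tendsto (fun n => Real.exp (-(x / 2 * κ / t n)) * (1 + Real.pi ^ 2 * σ n ^ 2)) atTop
        (𝓝 0) := by
      have h1 := hκ (x / 2 * κ) (by positivity)
      have h2 : Tendsto (fun n => Real.exp (-(x / 2 * κ / t n))) atTop (𝓝 0) := by
        refine Real.tendsto_exp_neg_atTop_nhds_zero.comp ?_
        simp only [div_eq_mul_inv _ (t _)]
        exact (tendsto_inv_nhdsGT_zero.comp ht).const_mul_atTop (by positivity)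
      have h3 := h2.add (h1.const_mul (Real.pi ^ 2))
      rw [mul_zero, add_zero] at h3
      refine h3.congr fun n => ?_
      ring
    filter_upwards [ht0, ht1, hσ0, hσ, hW, hy.eventually_const_le (half_lt_self hx),
      hK.eventually_le_const one_pos] with n h1 h2 h3 h4 h5 h6 h7
    refine Eventually.of_forall fun v => ?_
    have hb1 : 0 < Real.exp (-(1 / 8) * v ^ 2) := Real.exp_pos _
    have hb2 : 0 < (1 + v ^ 2)⁻¹ := by positivity
    by_cases hv : v ∈ Ioc (-Real.pi * σ n) (Real.pi * σ n)
    swap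
    · simp only [hF, indicator_of_notMem hv, norm_zero]
      positivity
    simp only [hF, indicator_of_mem hv]
    rw [← Complex.ofReal_div, ← Complex.ofReal_natCast, norm_cexp_charExp]
    have hvpi : |v / σ n| ≤ Real.pi := by
      rw [abs_div, abs_of_pos h3, div_le_iff₀ h3, abs_le]
      exact ⟨by linarith [hv.1], hv.2⟩
    rcases le_total |v / σ n| ((16 * C)⁻¹ * t n) with hn | hn
    · have hr := re_charExp_le_near h0 hS h1 hC h5 hn
      refine le_trans (Real.exp_le_exp.2 ?_) (le_add_of_nonneg_right hb2.le)
      have hnn : 0 ≤ (v / σ n) ^ 2 * expSum A 1 (t n) / 4 := by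
        have := expSum_nonneg h0 1 (t n); positivity
      have e : x * ((v / σ n) ^ 2 * expSum A 1 (t n)) = v ^ 2 := by
        rw [mul_left_comm, ← h4, div_pow, div_mul_cancel₀ _ (by positivity)]
      calc y n * (charExp A (t n) (v / σ n)).re
          ≤ y n * -((v / σ n) ^ 2 * expSum A 1 (t n) / 4) := by
            gcongr
            linarith
        _ ≤ x / 2 * -((v / σ n) ^ 2 * expSum A 1 (t n) / 4) :=
            mul_le_mul_of_nonpos_right h6 (by linarith)
        _ = -(1 / 8) * v ^ 2 := by linear_combination (-1 / 8) * e
    · have hr := hfar (t n) h1 h2 (v / σ n) hn hvpi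
      refine le_trans ?_ (le_add_of_nonneg_left hb1.le)
      have hκt : 0 < κ / t n := by positivity
      have hle : y n * (charExp A (t n) (v / σ n)).re ≤ -(x / 2 * κ / t n) := by
        calc y n * (charExp A (t n) (v / σ n)).re ≤ y n * -(κ / t n) := by
              gcongr
              linarith
          _ ≤ x / 2 * -(κ / t n) := mul_le_mul_of_nonpos_right h6 (by linarith)
          _ = _ := by ring
      refine (Real.exp_le_exp.2 hle).trans ?_
      have hv2 : v ^ 2 ≤ Real.pi ^ 2 * σ n ^ 2 := by
        rw [← mul_pow]
        exact sq_le_sq' (by linarith [hv.1]) hv.2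
      rw [← one_div, le_div_iff₀ (by positivity)]
      refine le_trans ?_ h7
      gcongr
  · refine Eventually.of_forall fun v => ?_
    have hmem : ∀ᶠ n in atTop, v ∈ Ioc (-Real.pi * σ n) (Real.pi * σ n) := by
      have h1 := hσt.const_mul_atTop Real.pi_pos
      filter_upwards [h1.eventually_gt_atTop |v|] with n hn
      have := abs_lt.1 hn
      exact ⟨by linarith, by linarith⟩
    have herr : Tendsto (fun n => (y n : ℂ) * (charExp A (t n) (v / σ n) -
        (I * (v / σ n : ℝ) * expSum A 0 (t n) - (v / σ n : ℝ) ^ 2 / 2 * expSum A 1 (t n)))) atTop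
        (𝓝 0) := by
      have hlim : Tendsto (fun n => 2 * x * (4 * |v| ^ 3 * (C / x)) * (t n * σ n)⁻¹) atTop
          (𝓝 0) := by
        simpa using htσ.inv_tendsto_atTop.const_mul (2 * x * (4 * |v| ^ 3 * (C / x)))
      refine squeeze_zero_norm' ?_ hlim
      filter_upwards [ht0, hσ0, hσ, hW, hy.eventually_const_le (half_lt_self hx),
        hy.eventually_le_const (by linarith : x < 2 * x)] with n h1 h3 h4 h5 h6 h7
      have hyn : 0 ≤ y n := by linarith
      rw [norm_mul, Complex.norm_real, Real.norm_of_nonneg hyn, mul_assoc (2 * x)]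
      refine mul_le_mul h7 ((norm_charExp_sub_le h0 hS h1 _).trans ?_) (norm_nonneg _)
        (by positivity)
      rw [abs_div, abs_of_pos h3]
      have h8 : expSum A 2 (t n) ≤ C * (σ n ^ 2 / x) / t n := by
        rw [le_div_iff₀ h1, h4, mul_div_cancel_left₀ _ hx.ne']
        exact h5
      calc 4 * (|v| / σ n) ^ 3 * expSum A 2 (t n)
          ≤ 4 * (|v| / σ n) ^ 3 * (C * (σ n ^ 2 / x) / t n) := by gcongr
        _ = _ := by field_simp
    have hmain : Tendsto (fun n => I * ((y n * expSum A 0 (t n) - n) / σ n : ℝ) * v -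
        (y n / x : ℝ) * (v ^ 2 / 2)) atTop (𝓝 (I * ξ * v - v ^ 2 / 2)) := by
      have h1 := (Complex.continuous_ofReal.tendsto _).comp hξ
      have h2 := (Complex.continuous_ofReal.tendsto _).comp (hy.div_const x)
      rw [div_self hx.ne'] at h2
      have := ((h1.const_mul I).mul_const (v : ℂ)).sub (h2.mul_const ((v : ℂ) ^ 2 / 2))
      simpa only [Function.comp_def, Complex.ofReal_one, one_mul] using this
    have := (Complex.continuous_exp.tendsto _).comp (herr.add hmain)
    rw [zero_add] at this
    refine this.congr' ?_
    filter_upwards [hmem, hσ0, hσ] with n hn h3 h4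
    simp only [hF, indicator_of_mem hn, Function.comp_apply]
    congr 1
    have h4' : (σ n : ℂ) ^ 2 = x * expSum A 1 (t n) := by exact_mod_cast h4
    have hσn : (σ n : ℂ) ≠ 0 := by exact_mod_cast h3.ne'
    have hxn : (x : ℂ) ≠ 0 := by exact_mod_cast hx.ne'
    have e : (expSum A 1 (t n) : ℂ) = σ n ^ 2 / x := by rw [h4', mul_div_cancel_left₀ _ hxn]
    rw [e]
    push_cast
    field_simp
    ring

end LocalLimit

section CoefficientAsymptotics

open MeasureTheory Set Filter Topology

variable {A : ℕ → ℝ} {α γ : ℝ} {k : ℕ} {p : ℕ → ℂ} {Φ : ℂ → ℂ}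

theorem HasPoleExpansion.expSummable (h : HasPoleExpansion A α k p Φ) : ExpSummable A := by
  intro β t ht
  have hσ : α < |α| + |β| + 1 := by have := le_abs_self α; have := abs_nonneg β; linarith
  have hq : 0 < |α| + |β| + 1 + β := by have := neg_abs_le β; have := abs_nonneg α; linarith
  have key := (h.summable_gumbelSum hσ hq (-Real.log t)).mul_left
    (Real.exp ((|α| + |β| + 1 + β) * -Real.log t))
  refine key.congr fun δ => ?_
  have hN : (0 : ℝ) < δ + 1 := by positivity
  have h1 : Real.exp (Real.log (δ + 1) - -Real.log t) = (δ + 1) * t := by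
    rw [sub_neg_eq_add, Real.exp_add, Real.exp_log hN, Real.exp_log ht]
  rw [gumbel, h1, Real.rpow_def_of_pos hN, mul_right_comm (Real.exp _) (A δ), ← Real.exp_add,
    mul_assoc (A δ), ← Real.exp_add, mul_left_comm, ← Real.exp_add, mul_comm _ (A δ)]
  congr 2
  ring

theorem expSum_antitoneOn (h0 : ∀ δ, 0 ≤ A δ) (hS : ExpSummable A) (β : ℝ) {s t : ℝ} (hs : 0 < s)
    (hst : s ≤ t) : expSum A β t ≤ expSum A β s := by
  refine (hS β t (hs.trans_le hst)).tsum_le_tsum (fun δ => ?_) (hS β s hs)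
  have := h0 δ
  refine mul_le_mul_of_nonneg_left (Real.exp_le_exp.2 ?_) (by positivity)
  have : (0 : ℝ) ≤ δ + 1 := by positivity
  nlinarith

theorem tendsto_of_expSum_eq (h0 : ∀ δ, 0 ≤ A δ) (hS : ExpSummable A) {x : ℝ} (hx : 0 < x)
    {t : ℕ → ℝ} (ht : ∀ n : ℕ, 1 ≤ n → 0 < t n ∧ expSum A 0 (t n) = n / x) :
    Tendsto t atTop (𝓝[>] 0) := by
  refine tendsto_nhdsWithin_iff.2 ⟨?_, ?_⟩
  · refine tendsto_order.2 ⟨fun ε hε => ?_, fun ε hε => ?_⟩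
    · filter_upwards [eventually_ge_atTop 1] with n hn using hε.trans (ht n hn).1
    · have : Tendsto (fun n : ℕ => (n : ℝ) / x) atTop atTop :=
        tendsto_natCast_atTop_atTop.atTop_div_const hx
      filter_upwards [eventually_ge_atTop 1, this.eventually_gt_atTop (expSum A 0 ε)] with n hn h1
      by_contra! hle
      have := expSum_antitoneOn h0 hS 0 hε hle
      rw [(ht n hn).2] at this
      linarith
  · filter_upwards [eventually_ge_atTop 1] with n hn using (ht n hn).1

/-- The order of magnitude `t ^ (-α) * log (1 / t) ^ k` of `expSum A 0 t`. -/
noncomputable def poleScale (α : ℝ) (k : ℕ) (t : ℝ) : ℝ := t ^ (-α) * (-Real.log t) ^ k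

theorem HasPoleExpansion.tendsto_expSum_nhdsGT (h : HasPoleExpansion A α k p Φ)
    (hγ : p k = γ) {β : ℝ} (hp : 0 < α + β) :
    Tendsto (fun t => expSum A β t * t ^ β / poleScale α k t) (𝓝[>] 0)
      (𝓝 (Real.Gamma (α + β) * (γ / k.factorial))) := by
  have hV : Tendsto (fun t => -Real.log t) (𝓝[>] 0) atTop :=
    tendsto_neg_atBot_atTop.comp Real.tendsto_log_nhdsGT_zero
  refine ((h.tendsto_expSum hγ hp).comp hV).congr' ?_
  filter_upwards [self_mem_nhdsWithin] with t (ht : 0 < t)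
  have h1 : Real.exp (-((α + β) * -Real.log t)) = t ^ α * t ^ β := by
    rw [← Real.rpow_add ht, Real.rpow_def_of_pos ht]; congr 1; ring
  rw [Function.comp_apply, h1, neg_neg, Real.exp_log ht, poleScale, Real.rpow_neg ht.le]
  have : t ^ α ≠ 0 := (Real.rpow_pos_of_pos ht α).ne'
  field_simp

/-- The order of magnitude of the standard deviation in terms of `t`. -/
noncomputable def devScale (α : ℝ) (k : ℕ) (t : ℝ) : ℝ :=
  poleScale α k t ^ ((α - 1) / (2 * α)) * (-Real.log t) ^ ((k : ℝ) / (2 * α))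

theorem eventually_neg_log_ge (R : ℝ) : ∀ᶠ t in 𝓝[>] (0 : ℝ), R ≤ -Real.log t :=
  (tendsto_neg_atBot_atTop.comp Real.tendsto_log_nhdsGT_zero).eventually_ge_atTop R

theorem eventually_poleScale_pos (α : ℝ) (k : ℕ) : ∀ᶠ t in 𝓝[>] (0 : ℝ), 0 < poleScale α k t := by
  filter_upwards [self_mem_nhdsWithin, eventually_neg_log_ge 1] with t (ht : 0 < t) h1
  have : 0 < -Real.log t := by linarith
  rw [poleScale]
  positivity

theorem eventually_devScale_pos (α : ℝ) (k : ℕ) : ∀ᶠ t in 𝓝[>] (0 : ℝ), 0 < devScale α k t := by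
  filter_upwards [eventually_poleScale_pos α k, eventually_neg_log_ge 1] with t ht h1
  have : 0 < -Real.log t := by linarith
  rw [devScale]
  positivity

theorem eventually_devScale_sq (hα : α ≠ 0) (k : ℕ) :
    ∀ᶠ t in 𝓝[>] (0 : ℝ), devScale α k t ^ 2 = poleScale α k t * t := by
  filter_upwards [self_mem_nhdsWithin, eventually_neg_log_ge 1] with t (ht : 0 < t) h1
  have hV : 0 < -Real.log t := by linarith
  have h2 : ((α - 1) / (2 * α)) * ((2 : ℕ) : ℝ) = (α - 1) / α := by push_cast; field_simp
  have h3 : ((k : ℝ) / (2 * α)) * ((2 : ℕ) : ℝ) = k / α := by push_cast; field_simp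
  have h4 : (t ^ (-α)) ^ ((α - 1) / α) = t ^ (-α) * t := by
    rw [← Real.rpow_mul ht.le, ← Real.rpow_add_one ht.ne']
    congr 1
    field_simp
    ring
  have h5 : ((-Real.log t) ^ k) ^ ((α - 1) / α) * (-Real.log t) ^ ((k : ℝ) / α) =
      (-Real.log t) ^ k := by
    rw [← Real.rpow_natCast, ← Real.rpow_mul hV.le, ← Real.rpow_add hV]
    congr 1
    field_simp
    ring
  rw [devScale, mul_pow, ← Real.rpow_mul_natCast (by rw [poleScale]; positivity), h2,
    ← Real.rpow_mul_natCast hV.le, h3, poleScale, Real.mul_rpow (by positivity) (by positivity), h4,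
    mul_assoc, h5]
  ring

theorem tendsto_devScale (hα : 1 < α) (k : ℕ) : Tendsto (devScale α k) (𝓝[>] 0) atTop := by
  have h1 : Tendsto (fun t : ℝ => t ^ (1 - α)) (𝓝[>] 0) atTop := by
    have := (tendsto_rpow_atTop (y := α - 1) (by linarith)).comp tendsto_inv_nhdsGT_zero
    refine this.congr' ?_
    filter_upwards [self_mem_nhdsWithin] with t (ht : 0 < t)
    rw [Function.comp_apply, Real.inv_rpow ht.le, ← Real.rpow_neg ht.le, neg_sub]
  have h2 : Tendsto (fun t => Real.sqrt (t ^ (1 - α))) (𝓝[>] 0) atTop :=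
    Real.tendsto_sqrt_atTop.comp h1
  refine tendsto_atTop_mono' _ ?_ h2
  filter_upwards [self_mem_nhdsWithin, eventually_neg_log_ge 1, eventually_devScale_pos α k,
    eventually_devScale_sq (by linarith : α ≠ 0) k] with t (ht : 0 < t) h3 h4 h5
  refine Real.sqrt_le_iff.2 ⟨h4.le, ?_⟩
  rw [h5, poleScale, show 1 - α = -α + 1 by ring, Real.rpow_add_one ht.ne', mul_right_comm]
  exact le_mul_of_one_le_right (by positivity) (one_le_pow₀ h3)

theorem tendsto_exp_neg_div_mul_poleScale (α : ℝ) (k : ℕ) {κ : ℝ} (hκ : 0 < κ) :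
    Tendsto (fun t => Real.exp (-(κ / t)) * (poleScale α k t / t)) (𝓝[>] 0) (𝓝 0) := by
  have h1 := (tendsto_rpow_mul_exp_neg_mul_atTop_nhds_zero (α + 1 + k) κ hκ).comp
    tendsto_inv_nhdsGT_zero
  refine squeeze_zero_norm' ?_ h1
  filter_upwards [self_mem_nhdsWithin, eventually_neg_log_ge 1] with t (ht : 0 < t) h3
  have hV : 0 < -Real.log t := by linarith
  have hle : -Real.log t ≤ t⁻¹ := by
    rw [← Real.log_inv]
    exact (Real.log_le_sub_one_of_pos (inv_pos.2 ht)).trans (by linarith)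
  rw [Real.norm_of_nonneg (by rw [poleScale]; positivity), Function.comp_apply, poleScale,
    mul_comm, neg_mul, ← div_eq_mul_inv]
  gcongr
  have ht' : 0 < t⁻¹ := inv_pos.2 ht
  calc t ^ (-α) * (-Real.log t) ^ k / t = (t⁻¹) ^ (α + 1) * (-Real.log t) ^ k := by
        rw [Real.rpow_add_one ht'.ne', Real.inv_rpow ht.le, Real.rpow_neg ht.le]; ring
    _ ≤ (t⁻¹) ^ (α + 1) * (t⁻¹) ^ k := by gcongr
    _ = _ := by rw [Real.rpow_add ht' (α + 1) k, Real.rpow_natCast]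

end CoefficientAsymptotics

section Normalization

open MeasureTheory Set Filter Topology

variable {α : ℝ} {k : ℕ}

theorem tendsto_log_div_neg_log {t : ℕ → ℝ} (ht : Tendsto t atTop (𝓝[>] 0)) {κ : ℝ} (hκ : 0 < κ)
    (hn : Tendsto (fun n : ℕ => (n : ℝ) / poleScale α k (t n)) atTop (𝓝 κ)) :
    Tendsto (fun n : ℕ => Real.log n / -Real.log (t n)) atTop (𝓝 α) := by
  have hV : Tendsto (fun n => -Real.log (t n)) atTop atTop :=
    (tendsto_neg_atBot_atTop.comp Real.tendsto_log_nhdsGT_zero).comp ht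
  have h1 : Tendsto (fun n : ℕ => Real.log (n / poleScale α k (t n)) / -Real.log (t n)) atTop
      (𝓝 0) := ((Real.continuousAt_log hκ.ne').tendsto.comp hn).div_atTop hV
  have h2 : Tendsto (fun n => Real.log (-Real.log (t n)) / -Real.log (t n)) atTop (𝓝 0) :=
    (Real.isLittleO_log_id_atTop.tendsto_div_nhds_zero).comp hV
  have h3 := (h1.add (h2.const_mul (k : ℝ))).add_const α
  rw [mul_zero, add_zero, zero_add] at h3
  refine h3.congr' ?_
  filter_upwards [ht.eventually (eventually_poleScale_pos α k), hV.eventually_gt_atTop 0,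
    (tendsto_nhdsWithin_iff.1 ht).2, eventually_ge_atTop 1] with n h4 h5 (h6 : 0 < t n) h7
  have hn0 : (n : ℝ) ≠ 0 := by positivity
  rw [Real.log_div hn0 h4.ne', poleScale, Real.log_mul (by positivity) (by positivity),
    Real.log_rpow h6, Real.log_pow]
  have : Real.log (t n) ≠ 0 := by linarith
  field_simp
  ring

theorem tendsto_normalizer {t : ℕ → ℝ} (ht : Tendsto t atTop (𝓝[>] 0)) {κ : ℝ} (hκ : 0 < κ)
    (hα : 0 < α) (hn : Tendsto (fun n : ℕ => (n : ℝ) / poleScale α k (t n)) atTop (𝓝 κ)) :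
    Tendsto (fun n : ℕ => (n : ℝ) ^ ((α - 1) / (2 * α)) * Real.log n ^ ((k : ℝ) / (2 * α)) /
      devScale α k (t n)) atTop (𝓝 (κ ^ ((α - 1) / (2 * α)) * α ^ ((k : ℝ) / (2 * α)))) := by
  have h1 := (hn.rpow_const (p := (α - 1) / (2 * α)) (Or.inl hκ.ne')).mul
    ((tendsto_log_div_neg_log ht hκ hn).rpow_const (p := (k : ℝ) / (2 * α)) (Or.inl hα.ne'))
  refine h1.congr' ?_
  filter_upwards [ht.eventually (eventually_poleScale_pos α k),
    ht.eventually (eventually_neg_log_ge 1), eventually_ge_atTop 1] with n h4 h5 h6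
  have hV : 0 < -Real.log (t n) := by linarith
  have hlog : 0 ≤ Real.log n := Real.log_nonneg (by exact_mod_cast h6)
  rw [Real.div_rpow (by positivity) h4.le, Real.div_rpow hlog hV.le, devScale, div_mul_div_comm]

theorem tendsto_scaled_normalization {t b : ℕ → ℝ} (ht : Tendsto t atTop (𝓝[>] 0)) {κ : ℝ}
    (hκ : 0 < κ) (hα : 1 < α)
    (hn : Tendsto (fun n : ℕ => (n : ℝ) / poleScale α k (t n)) atTop (𝓝 κ))
    (hb : Tendsto (fun n : ℕ => b n / ((α * (α - 1)) ^ (-(1 / 2 : ℝ)) *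
      α ^ (-((k : ℝ) / (2 * α))) * κ ^ (1 / (2 * α)) *
        (n : ℝ) ^ ((α - 1) / (2 * α)) * Real.log n ^ ((k : ℝ) / (2 * α)))) atTop (𝓝 1)) :
    Tendsto (fun n => b n / devScale α k (t n)) atTop (𝓝 (Real.sqrt (κ / (α * (α - 1))))) := by
  have hα0 : 0 < α := by linarith
  have hα1 : 0 < α - 1 := by linarith
  have hlim : (α * (α - 1)) ^ (-(1 / 2 : ℝ)) * α ^ (-((k : ℝ) / (2 * α))) * κ ^ (1 / (2 * α)) *
      (κ ^ ((α - 1) / (2 * α)) * α ^ ((k : ℝ) / (2 * α))) = Real.sqrt (κ / (α * (α - 1))) := by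
    have h1 : κ ^ (1 / (2 * α)) * κ ^ ((α - 1) / (2 * α)) = Real.sqrt κ := by
      rw [← Real.rpow_add hκ, Real.sqrt_eq_rpow]
      congr 1
      field_simp
      ring
    have h2 : α ^ (-((k : ℝ) / (2 * α))) * α ^ ((k : ℝ) / (2 * α)) = 1 := by
      rw [← Real.rpow_add hα0, neg_add_cancel, Real.rpow_zero]
    rw [Real.rpow_neg (by positivity), ← Real.sqrt_eq_rpow, Real.sqrt_div hκ.le,
      div_eq_mul_inv (Real.sqrt κ)]
    generalize (k : ℝ) / (2 * α) = e at h2 ⊢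
    linear_combination (Real.sqrt (α * (α - 1)))⁻¹ * (α ^ (-e) * α ^ e * h1 + Real.sqrt κ * h2)
  have h := (hb.mul ((tendsto_normalizer ht hκ hα0 hn).const_mul
    ((α * (α - 1)) ^ (-(1 / 2 : ℝ)) * α ^ (-((k : ℝ) / (2 * α))) * κ ^ (1 / (2 * α)))))
  rw [one_mul, hlim] at h
  refine h.congr' ?_
  filter_upwards [eventually_ge_atTop 2] with n hn2
  have hn1 : (1 : ℝ) < n := by exact_mod_cast hn2
  have hlog : 0 < Real.log n := Real.log_pos hn1
  have hC : (α * (α - 1)) ^ (-(1 / 2 : ℝ)) * α ^ (-((k : ℝ) / (2 * α))) *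
      κ ^ (1 / (2 * α)) ≠ 0 := by
    positivity
  have hD : (n : ℝ) ^ ((α - 1) / (2 * α)) * Real.log n ^ ((k : ℝ) / (2 * α)) ≠ 0 := by positivity
  rw [mul_assoc (_ * _) ((n : ℝ) ^ _)]
  field_simp

theorem tendsto_exp_sub_one_div : Tendsto (dslope Real.exp 0) (𝓝 0) (𝓝 1) := by
  have := (continuousAt_dslope_same.2 Real.differentiable_exp.differentiableAt).tendsto (x := 0)
  simpa [dslope_same] using this

theorem exp_sub_one_eq (u : ℝ) : Real.exp u - 1 = u * dslope Real.exp 0 u := by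
  have := sub_smul_dslope Real.exp 0 u
  simpa using this.symm

theorem abs_exp_sub_one_sub_id_sub_sq_le {u : ℝ} (hu : |u| ≤ 1) :
    |Real.exp u - 1 - u - u ^ 2 / 2| ≤ |u| ^ 3 := by
  have := Real.exp_bound hu (n := 3) (by norm_num)
  simp only [Finset.sum_range_succ, Finset.sum_range_zero] at this
  norm_num [Nat.factorial] at this
  have h3 : 0 ≤ |u| ^ 3 := by positivity
  refine le_trans (le_of_eq ?_) (this.trans (by linarith))
  congr 1
  ring

theorem tendsto_exp_sub_one_sub_id_mul {u X : ℕ → ℝ} {ℓ : ℝ} (hu : Tendsto u atTop (𝓝 0))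
    (hX : ∀ n, 0 ≤ X n) (huX : Tendsto (fun n => u n ^ 2 * X n) atTop (𝓝 ℓ)) :
    Tendsto (fun n => (Real.exp (u n) - 1 - u n) * X n) atTop (𝓝 (ℓ / 2)) := by
  have h1 : Tendsto (fun n => |u n| * (u n ^ 2 * X n)) atTop (𝓝 0) := by
    simpa using hu.abs.mul huX
  have h2 : Tendsto (fun n => (Real.exp (u n) - 1 - u n - u n ^ 2 / 2) * X n) atTop (𝓝 0) := by
    refine squeeze_zero_norm' ?_ h1
    have hu1 : ∀ᶠ n in atTop, |u n| ≤ 1 := by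
      have := hu.abs
      rw [abs_zero] at this
      exact this.eventually_le_const one_pos
    filter_upwards [hu1] with n hn
    rw [norm_mul, Real.norm_eq_abs, Real.norm_of_nonneg (hX n), ← mul_assoc]
    rw [← sq_abs (u n), ← pow_succ', sq_abs]
    exact mul_le_mul_of_nonneg_right (abs_exp_sub_one_sub_id_sub_sq_le hn) (hX n)
  have h3 := h2.add (huX.div_const 2)
  rw [zero_add] at h3
  refine h3.congr fun n => ?_
  ring

end Normalization

section CoefficientRatio

open MeasureTheory Set Filter Topology

variable {A : ℕ → ℝ}

/-- `h` is the sequence `n ! [zⁿ] exp (y ∑ A δ z ^ (δ + 1) / (δ + 1))`. -/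
structure IsExpCoeff (A : ℕ → ℝ) (y : ℝ) (h : ℕ → ℝ) : Prop where
  zero : h 0 = 1
  succ : ∀ n, h (n + 1) = ∑ k ∈ Finset.range (n + 1),
    (n.choose k : ℝ) * (y * (A k * k.factorial)) * h (n - k)

theorem IsExpCoeff.eq_integral (h0 : ∀ δ, 0 ≤ A δ) (hS : ExpSummable A) {y : ℝ} {h : ℕ → ℝ}
    (hh : IsExpCoeff A y h) (n : ℕ) {t : ℝ} (ht : 0 < t) :
    ((2 * Real.pi * (h n / n.factorial) : ℝ) : ℂ) =
      Real.exp (n * t + y * expSum A (-1) t) * ∫ θ in (-Real.pi)..Real.pi,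
        Complex.exp (y * charExp A t θ - n * θ * Complex.I) := by
  rw [coeff_eq_circleIntegral h0 (fun r hr hr1 => hS.summable_mul_pow hr hr1) y hh.zero
      hh.succ n ht,
    Real.exp_add, Complex.ofReal_mul, mul_assoc,
    ← intervalIntegral.integral_const_mul (Real.exp (y * expSum A (-1) t) : ℂ)]
  congr 1
  refine intervalIntegral.integral_congr fun θ _ => ?_
  rw [powPrimitive_cexp hS ht, Complex.ofReal_exp, ← Complex.exp_add]
  congr 1
  push_cast
  ring

theorem tendsto_expCoeff_ratio {c C x ξ : ℝ} (hc : 0 < c) (hA : ∀ δ : ℕ, c * ((δ : ℝ) + 1) ≤ A δ)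
    (hS : ExpSummable A) (hC : 0 < C) (hx : 0 < x) {t y σ : ℕ → ℝ}
    (ht : Tendsto t atTop (𝓝[>] 0)) (hy : Tendsto y atTop (𝓝 x)) (hσ0 : ∀ᶠ n in atTop, 0 < σ n)
    (hσ : ∀ᶠ n in atTop, σ n ^ 2 = x * expSum A 1 (t n))
    (htσ : Tendsto (fun n => t n * σ n) atTop atTop)
    (hW : ∀ᶠ n in atTop, expSum A 2 (t n) * t n ≤ C * expSum A 1 (t n))
    (hκ : ∀ κ > 0, Tendsto (fun n => Real.exp (-(κ / t n)) * σ n ^ 2) atTop (𝓝 0))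
    (hn : ∀ᶠ n : ℕ in atTop, x * expSum A 0 (t n) = n)
    (hξ : Tendsto (fun n => (y n * expSum A 0 (t n) - n) / σ n) atTop (𝓝 ξ))
    {h : ℝ → ℕ → ℝ} (hh : ∀ y, IsExpCoeff A y (h y)) :
    Tendsto (fun n => h (y n) n / h x n * Real.exp (-((y n - x) * expSum A (-1) (t n)))) atTop
      (𝓝 (Real.exp (-(ξ ^ 2 / 2)))) := by
  have h0 : ∀ δ, 0 ≤ A δ := fun δ => le_trans (by positivity) (hA δ)
  have hξ0 : Tendsto (fun n => (x * expSum A 0 (t n) - n) / σ n) atTop (𝓝 0) := by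
    refine tendsto_const_nhds.congr' ?_
    filter_upwards [hn] with n hn
    rw [hn, sub_self, zero_div]
  have L1 := tendsto_local_limit hc hA hS hC hx ht hy hσ0 hσ htσ hW hκ hξ
  have L2 := tendsto_local_limit hc hA hS hC hx ht (tendsto_const_nhds (x := x)) hσ0 hσ htσ hW hκ
    hξ0
  have hpi : (2 * Real.pi : ℂ) ^ (1 / 2 : ℂ) ≠ 0 := by
    have : (2 * Real.pi : ℂ) ≠ 0 := by exact_mod_cast Real.two_pi_pos.ne'
    rw [Ne, Complex.cpow_eq_zero_iff]
    tauto
  have L := L1.div L2 (mul_ne_zero hpi (Complex.exp_ne_zero _))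
  have hlim : (2 * Real.pi : ℂ) ^ (1 / 2 : ℂ) * Complex.exp (-(ξ ^ 2 / 2)) /
      ((2 * Real.pi : ℂ) ^ (1 / 2 : ℂ) * Complex.exp (-(((0 : ℝ) : ℂ) ^ 2 / 2))) =
      ((Real.exp (-(ξ ^ 2 / 2)) : ℝ) : ℂ) := by
    rw [mul_div_mul_left _ _ hpi]
    simp
  rw [hlim] at L
  have key := (Complex.continuous_re.tendsto _).comp L
  rw [Complex.ofReal_re] at key
  refine key.congr' ?_
  filter_upwards [hσ0, (tendsto_nhdsWithin_iff.1 ht).2] with n hσn (htn : 0 < t n)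
  have e1 := (hh (y n)).eq_integral h0 hS n htn
  have e2 := (hh x).eq_integral h0 hS n htn
  have hσn' : (σ n : ℂ) ≠ 0 := by exact_mod_cast hσn.ne'
  have hfac : (n.factorial : ℝ) ≠ 0 := by positivity
  have hpr := Real.pi_ne_zero
  simp only [Function.comp_apply, Pi.div_apply]
  rw [mul_div_mul_left _ _ hσn', ← Complex.ofReal_re (h (y n) n / h x n * _)]
  congr 1
  have e3 : h (y n) n / h x n = (2 * Real.pi * (h (y n) n / n.factorial)) /
      (2 * Real.pi * (h x n / n.factorial)) := by field_simp
  rw [e3, Complex.ofReal_mul, Complex.ofReal_div, e1, e2,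
    show (n : ℝ) * t n + y n * expSum A (-1) (t n) = (n * t n + x * expSum A (-1) (t n)) +
      (y n - x) * expSum A (-1) (t n) by ring, Real.exp_add _ ((y n - x) * _), Real.exp_neg]
  have h4 : (Real.exp ((y n - x) * expSum A (-1) (t n)) : ℂ) ≠ 0 := by
    exact_mod_cast Real.exp_ne_zero _
  have h5 : (Real.exp (n * t n + x * expSum A (-1) (t n)) : ℂ) ≠ 0 := by
    exact_mod_cast Real.exp_ne_zero _
  rw [Complex.ofReal_mul, Complex.ofReal_inv, mul_assoc, mul_div_mul_left _ _ h5]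
  have h6 : ∀ J₁ J₂ : ℂ, J₁ / J₂ = Real.exp ((y n - x) * expSum A (-1) (t n)) * J₁ / J₂ *
      (Real.exp ((y n - x) * expSum A (-1) (t n)) : ℂ)⁻¹ := fun J₁ J₂ => by field_simp
  exact h6 _ _

end CoefficientRatio

section LogRatio

open MeasureTheory Set Filter Topology

variable {A : ℕ → ℝ} {α γ : ℝ} {k : ℕ} {p : ℕ → ℂ} {Φ : ℂ → ℂ}

theorem tendsto_log_expCoeff_ratio (hP : HasPoleExpansion A α k p Φ) (hp : p k = γ) (hγ : 0 < γ)
    (hα : 2 ≤ α) {c x : ℝ} (hc : 0 < c) (hA : ∀ δ : ℕ, c * ((δ : ℝ) + 1) ≤ A δ) (hx : 0 < x)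
    {t a b : ℕ → ℝ} (ht : ∀ n : ℕ, 1 ≤ n → 0 < t n ∧ expSum A 0 (t n) = n / x)
    (hb0 : ∀ n, 0 < b n)
    (hb : Tendsto (fun n => b n / devScale α k (t n)) atTop
      (𝓝 (Real.sqrt (x * (Real.Gamma α * (γ / k.factorial)) / (α * (α - 1))))))
    (ha : Tendsto (fun n => (a n - x * expSum A (-1) (t n)) / devScale α k (t n)) atTop (𝓝 0))
    {h : ℝ → ℕ → ℝ} (hh : ∀ y, IsExpCoeff A y (h y)) (hpos : ∀ y > 0, ∀ n, 0 < h y n) (s : ℝ) :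
    Tendsto (fun n => -(s * a n / b n) + Real.log (h (x * Real.exp (s / b n)) n / h x n)) atTop
      (𝓝 (s ^ 2 / 2)) := by
  have hS := hP.expSummable
  have htz := tendsto_of_expSum_eq hP.nonneg hS hx ht
  have htpos : ∀ᶠ n in atTop, 0 < t n := (tendsto_nhdsWithin_iff.1 htz).2
  let P : ℕ → ℝ := fun n => poleScale α k (t n)
  let Q : ℕ → ℝ := fun n => devScale α k (t n)
  have hPpos : ∀ᶠ n in atTop, 0 < P n := htz.eventually (eventually_poleScale_pos α k)
  have hQpos : ∀ᶠ n in atTop, 0 < Q n := htz.eventually (eventually_devScale_pos α k)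
  have hQsq : ∀ᶠ n in atTop, Q n ^ 2 = P n * t n :=
    htz.eventually (eventually_devScale_sq (by linarith : α ≠ 0) k)
  have hQ : Tendsto Q atTop atTop := (tendsto_devScale (by linarith : 1 < α) k).comp htz
  set g : ℝ := γ / k.factorial with hg
  replace hb : Tendsto (fun n => b n / Q n) atTop
    (𝓝 (Real.sqrt (x * (Real.Gamma α * g) / (α * (α - 1))))) := hb
  replace ha : Tendsto (fun n => (a n - x * expSum A (-1) (t n)) / Q n) atTop (𝓝 0) := ha
  have hg0 : 0 < g := by positivity
  have hw : ∀ β : ℝ, 0 < α + β → Tendsto (fun n => expSum A β (t n) * t n ^ β / P n) atTop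
      (𝓝 (Real.Gamma (α + β) * g)) := fun β hβ => (hP.tendsto_expSum_nhdsGT hp hβ).comp htz
  set M := Real.Gamma (α - 1) with hM
  have hM0 : 0 < M := Real.Gamma_pos_of_pos (by linarith)
  have hα1 : 0 < α - 1 := by linarith
  have hΓ0 : Real.Gamma α = (α - 1) * M := by
    rw [hM, ← Real.Gamma_add_one hα1.ne', sub_add_cancel]
  have hΓ1 : Real.Gamma (α + 1) = α * ((α - 1) * M) := by
    rw [Real.Gamma_add_one (by linarith), hΓ0]
  have wm : Tendsto (fun n => expSum A (-1) (t n) / Q n ^ 2) atTop (𝓝 (M * g)) := by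
    refine (hw (-1) (by linarith)).congr' ?_
    filter_upwards [hQsq, htpos] with n h1 h2
    rw [h1, Real.rpow_neg_one]
    field_simp
  have w0 : Tendsto (fun n => expSum A 0 (t n) / P n) atTop (𝓝 ((α - 1) * M * g)) := by
    have := hw 0 (by linarith)
    rw [add_zero, hΓ0] at this
    simpa only [Real.rpow_zero, mul_one] using this
  have w1 : Tendsto (fun n => expSum A 1 (t n) * t n / P n) atTop (𝓝 (α * ((α - 1) * M) * g)) := by
    have := hw 1 (by linarith)
    rw [hΓ1] at this
    simpa only [Real.rpow_one] using this
  have w2 : Tendsto (fun n => expSum A 2 (t n) * t n ^ 2 / P n) atTop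
      (𝓝 (Real.Gamma (α + 2) * g)) := by
    have := hw 2 (by linarith)
    simpa only [Real.rpow_two] using this
  have hG1 : 0 < α * ((α - 1) * M) * g := by positivity
  have hG2 : 0 < Real.Gamma (α + 2) * g := mul_pos (Real.Gamma_pos_of_pos (by linarith)) hg0
  set b₀ := Real.sqrt (x * (Real.Gamma α * g) / (α * (α - 1))) with hb₀
  have hb₀sq : b₀ ^ 2 = x * M * g / α := by
    rw [hb₀, hΓ0, Real.sq_sqrt (by positivity)]
    field_simp
  have hb₀pos : 0 < b₀ := by
    rw [hb₀, hΓ0]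
    positivity
  set s₀ := Real.sqrt (x * (α * ((α - 1) * M) * g)) with hs₀
  have hs₀sq : s₀ ^ 2 = x * (α * ((α - 1) * M) * g) := by rw [hs₀, Real.sq_sqrt (by positivity)]
  have hs₀pos : 0 < s₀ := by positivity
  set σ : ℕ → ℝ := fun n => Real.sqrt (x * expSum A 1 (t n)) with hσdef
  have hσ : ∀ n, σ n ^ 2 = x * expSum A 1 (t n) := fun n =>
    Real.sq_sqrt (mul_nonneg hx.le (expSum_nonneg hP.nonneg 1 _))
  have hσlim : Tendsto (fun n => σ n * t n / Q n) atTop (𝓝 s₀) := by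
    refine ((Real.continuous_sqrt.tendsto _).comp (w1.const_mul x)).congr' ?_
    filter_upwards [hQsq, hQpos, htpos, hPpos] with n h1 h2 h3 h4
    have e : x * (expSum A 1 (t n) * t n / P n) = x * expSum A 1 (t n) * (t n / Q n) ^ 2 := by
      rw [div_pow, h1]
      field_simp
    rw [Function.comp_apply, e, Real.sqrt_mul (mul_nonneg hx.le (expSum_nonneg hP.nonneg 1 _)),
      Real.sqrt_sq (div_pos h3 h2).le, mul_div_assoc]
  have hσ0 : ∀ᶠ n in atTop, 0 < σ n := by
    filter_upwards [hσlim.eventually_const_lt hs₀pos, hQpos, htpos] with n h1 h2 h3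
    rw [lt_div_iff₀ h2, zero_mul] at h1
    exact pos_of_mul_pos_left h1 h3.le
  have htσ : Tendsto (fun n => t n * σ n) atTop atTop := by
    refine (hσlim.pos_mul_atTop hs₀pos hQ).congr' ?_
    filter_upwards [hQpos] with n h1
    rw [div_mul_cancel₀ _ h1.ne', mul_comm]
  have hbtop : Tendsto b atTop atTop := by
    refine (hb.pos_mul_atTop hb₀pos hQ).congr' ?_
    filter_upwards [hQpos] with n h1
    rw [div_mul_cancel₀ _ h1.ne']
  have hu : Tendsto (fun n => s / b n) atTop (𝓝 0) := hbtop.const_div_atTop s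
  have hy : Tendsto (fun n => x * Real.exp (s / b n)) atTop (𝓝 x) := by
    simpa using ((Real.continuous_exp.tendsto 0).comp hu).const_mul x
  have hW : ∀ᶠ n in atTop, expSum A 2 (t n) * t n ≤
      (Real.Gamma (α + 2) * g / (α * ((α - 1) * M) * g) + 1) * expSum A 1 (t n) := by
    have := (w2.div w1 hG1.ne').eventually_le_const (lt_add_one _)
    filter_upwards [this, htpos, hPpos, w1.eventually_const_lt hG1] with n h1 h2 h3 h4
    have h5 : expSum A 1 (t n) * t n > 0 := by rwa [lt_div_iff₀ h3, zero_mul] at h4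
    rw [Pi.div_apply, div_div_div_cancel_right₀ h3.ne', div_le_iff₀ h5] at h1
    refine le_of_mul_le_mul_right ?_ h2
    linear_combination h1
  have hκ : ∀ κ > 0, Tendsto (fun n => Real.exp (-(κ / t n)) * σ n ^ 2) atTop (𝓝 0) := by
    intro κ hκ
    have hd : Tendsto (fun n => Real.exp (-(κ / t n)) * (P n / t n)) atTop (𝓝 0) :=
      (tendsto_exp_neg_div_mul_poleScale α k hκ).comp htz
    have := hd.mul (w1.const_mul x)
    rw [zero_mul] at this
    refine this.congr' ?_
    filter_upwards [htpos, hPpos] with n h1 h2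
    rw [hσ]
    field_simp
  have hn : ∀ᶠ n : ℕ in atTop, x * expSum A 0 (t n) = n := by
    filter_upwards [eventually_ge_atTop 1] with n h1
    rw [(ht n h1).2, mul_div_cancel₀ _ hx.ne']
  have hξ : Tendsto (fun n : ℕ => (x * Real.exp (s / b n) * expSum A 0 (t n) - n) / σ n) atTop
      (𝓝 (s * x * ((α - 1) * M * g) / (b₀ * s₀))) := by
    have := (((tendsto_exp_sub_one_div.comp hu).const_mul (s * x)).mul w0).div (hb.mul hσlim)
      (mul_pos hb₀pos hs₀pos).ne'
    rw [mul_one] at this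
    refine this.congr' ?_
    filter_upwards [hn, hQsq, hQpos, htpos, hPpos, hσ0] with n h1 h2 h3 h4 h5 h6
    have e := exp_sub_one_eq (s / b n)
    have hbn := hb0 n
    have h2' : Q n * Q n = P n * t n := by rw [← sq]; exact h2
    calc _ = s * x * dslope Real.exp 0 (s / b n) * (expSum A 0 (t n) / P n) /
          (b n / Q n * (σ n * t n / Q n)) := rfl
      _ = s * x * dslope Real.exp 0 (s / b n) * (expSum A 0 (t n) / P n) /
          (b n * σ n * t n / (Q n * Q n)) := by rw [div_mul_div_comm]; ring
      _ = (s / b n * dslope Real.exp 0 (s / b n)) * (x * expSum A 0 (t n)) / σ n := by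
        rw [h2']
        field_simp
      _ = _ := by
        rw [← e, ← h1]
        ring
  have hr := tendsto_expCoeff_ratio hc hA hS (by positivity) hx htz hy hσ0 (Eventually.of_forall hσ)
    htσ hW hκ hn hξ hh
  have hlogr := (Real.continuousAt_log (Real.exp_ne_zero _)).tendsto.comp hr
  rw [Real.log_exp] at hlogr
  have huX : Tendsto (fun n => (s / b n) ^ 2 * (x * expSum A (-1) (t n))) atTop
      (𝓝 (s ^ 2 * (x * (M * g)) / b₀ ^ 2)) := by
    refine (((wm.const_mul x).const_mul (s ^ 2)).div (hb.pow 2) (by positivity)).congr' ?_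
    filter_upwards [hQpos] with n h1
    have hbn := hb0 n
    rw [Pi.div_apply]
    field_simp
  have hexp := tendsto_exp_sub_one_sub_id_mul hu
    (fun n => mul_nonneg hx.le (expSum_nonneg hP.nonneg (-1) (t n))) huX
  have hcentre := (ha.div hb hb₀pos.ne').const_mul s
  have hall := (hexp.sub hcentre).add hlogr
  have hlim : s ^ 2 * (x * (M * g)) / b₀ ^ 2 / 2 - s * (0 / b₀) +
      -((s * x * ((α - 1) * M * g) / (b₀ * s₀)) ^ 2 / 2) = s ^ 2 / 2 := by
    rw [div_pow, mul_pow b₀, hb₀sq, hs₀sq]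
    field_simp
    ring
  rw [hlim] at hall
  refine hall.congr' ?_
  filter_upwards [hQpos] with n h1
  have hbn := hb0 n
  have h3 := hpos _ (mul_pos hx (Real.exp_pos (s / b n))) n
  have h4 := hpos x hx n
  rw [Function.comp_apply, Real.log_mul (div_pos h3 h4).ne' (Real.exp_ne_zero _), Real.log_exp,
    Pi.div_apply, div_div_div_cancel_right₀ h1.ne']
  field_simp
  ring

end LogRatio

section SubgroupGrowth

open Set Filter Topology

theorem hasPoleExpansion_of_dirichletSeries {A : ℕ → ℕ} {α : ℝ} {m : ℕ} (hm : 1 ≤ m) {γ : ℂ}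
    {ν : ℕ → ℂ} {Φ : ℂ → ℂ} (hΦ : ContinuousOn Φ {s : ℂ | α ≤ s.re})
    (hsum : ∀ s : ℂ, α < s.re → Summable fun δ : ℕ => ‖(A δ : ℂ) * ((δ + 1 : ℕ) : ℂ) ^ (-s)‖)
    (hval : ∀ s : ℂ, α < s.re → ∑' δ : ℕ, (A δ : ℂ) * ((δ + 1 : ℕ) : ℂ) ^ (-s) =
      γ / (s - (α : ℂ)) ^ m + (∑ j ∈ Finset.Icc 1 (m - 1), ν j / (s - (α : ℂ)) ^ j) + Φ s) :
    HasPoleExpansion (fun δ => (A δ : ℝ)) α (m - 1) (fun j => if j = m - 1 then γ else ν (j + 1))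
      Φ := by
  have hpow : ∀ (δ : ℕ) (s : ℂ),
      ((δ + 1 : ℕ) : ℂ) ^ (-s) = Complex.exp (-(s * Real.log (δ + 1))) := fun δ s => by
    have h : ((Real.log (δ + 1) : ℝ) : ℂ) = Complex.log ((δ + 1 : ℕ) : ℂ) := by
      rw [← Complex.natCast_log]
      push_cast
      rfl
    rw [Complex.cpow_def_of_ne_zero (Nat.cast_ne_zero.2 δ.succ_ne_zero), h, mul_neg, mul_comm]
  obtain ⟨k, rfl⟩ : ∃ k, m = k + 1 := ⟨m - 1, by omega⟩
  refine ⟨fun δ => Nat.cast_nonneg _, hΦ, fun σ hσ => ?_, fun s hs => ?_⟩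
  · refine (hsum σ (by simpa using hσ)).congr fun δ => ?_
    rw [hpow, norm_mul, Complex.norm_natCast, Complex.norm_exp]
    congr 2
    rw [← Complex.ofReal_mul, ← Complex.ofReal_neg, Complex.ofReal_re]
  · have h := hval s hs
    simp only [hpow] at h
    simp only [Complex.ofReal_natCast]
    rw [h]
    congr 1
    rw [Nat.add_sub_cancel, Finset.sum_range_succ, if_pos rfl, add_comm]
    congr 1
    rw [← Finset.Ico_add_one_right_eq_Icc, Finset.range_eq_Ico, ← zero_add 1,
      ← Finset.sum_Ico_add' (fun j => ν j / (s - (α : ℂ)) ^ j) 0 k 1]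
    refine Finset.sum_congr rfl fun j hj => ?_
    rw [if_neg (by simp at hj; omega)]

variable {G : Type*} [Group G]

theorem expVal_exp_affine [Group.FG G] (n : ℕ) (x s a b : ℝ) :
    expVal G n x (fun y => Real.exp (s * (y - a) / b)) = Real.exp (-(s * a / b)) *
      (homWeight G (Fin n) (x * Real.exp (s / b)) / homWeight G (Fin n) x) := by
  have := finite_monoidHom_of_fg (G := G) (Equiv.Perm (Fin n))
  have := Fintype.ofFinite (G →* Equiv.Perm (Fin n))
  rw [expVal, homWeight, homWeight, ← mul_div_assoc, finsum_eq_sum_of_fintype,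
    finsum_eq_sum_of_fintype, finsum_eq_sum_of_fintype, finsum_eq_sum_of_fintype, Finset.mul_sum]
  congr 1
  refine Finset.sum_congr rfl fun φ _ => ?_
  have e : orbitCount φ = numOrbits φ := rfl
  rw [e, mul_pow, ← Real.exp_nat_mul, mul_left_comm, ← Real.exp_add, mul_comm]
  ring_nf

theorem isExpCoeff_homWeight [Group.FG G] (y : ℝ) :
    IsExpCoeff (fun δ => (aCount G (δ + 1) : ℝ)) y (fun n => homWeight G (Fin n) y) :=
  ⟨homWeight_zero y, fun n => homWeight_succ n y⟩

end SubgroupGrowth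

theorem log_mgf_limit
    (G : Type*) [Group G] [Group.FG G]
    (c : ℝ) (hc : 0 < c) (hgrowth : ∀ n : ℕ, 1 ≤ n → c * n ≤ (aCount G n : ℝ))
    (α : ℝ) (hα : 2 ≤ α) (m : ℕ) (hm : 1 ≤ m) (γ : ℝ) (hγ : 0 < γ)
    (ν : ℕ → ℂ) (Φ : ℂ → ℂ)
    (hΦc : ContinuousOn Φ {s : ℂ | α ≤ s.re})
    (hΦd : DifferentiableOn ℂ Φ {s : ℂ | α < s.re})
    (hsum : ∀ s : ℂ, α < s.re →
      Summable fun δ : ℕ => ‖(aCount G (δ + 1) : ℂ) * ((δ + 1 : ℕ) : ℂ) ^ (-s)‖)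
    (hval : ∀ s : ℂ, α < s.re →
      ∑' δ : ℕ, (aCount G (δ + 1) : ℂ) * ((δ + 1 : ℕ) : ℂ) ^ (-s) =
        (γ : ℂ) / (s - (α : ℂ)) ^ m
          + (∑ j ∈ Finset.Icc 1 (m - 1), ν j / (s - (α : ℂ)) ^ j) + Φ s)
    (x : ℝ) (hx : 0 < x)
    (t : ℕ → ℝ) (ht : ∀ n : ℕ, 1 ≤ n → 0 < t n ∧ Wfun G 0 (t n) = (n : ℝ) / x)
    (a : ℕ → ℝ) (b : ℕ → ℝ) (hbpos : ∀ n, 0 < b n)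
    (ha : Filter.Tendsto
      (fun n : ℕ => (a n - x * Wfun G (-1) (t n)) /
        ((n : ℝ) ^ ((α - 1) / (2 * α)) * Real.log n ^ (((m : ℝ) - 1) / (2 * α))))
      Filter.atTop (nhds 0))
    (hb : Filter.Tendsto
      (fun n : ℕ => b n /
        ((α * (α - 1)) ^ (-(1 / 2 : ℝ)) * α ^ (-(((m : ℝ) - 1) / (2 * α))) *
          (x * (Real.Gamma α * γ / (Nat.factorial (m - 1) : ℝ))) ^ (1 / (2 * α)) *
          (n : ℝ) ^ ((α - 1) / (2 * α)) * Real.log n ^ (((m : ℝ) - 1) / (2 * α))))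
      Filter.atTop (nhds 1)) :
    ∀ s : ℝ,
      Filter.Tendsto
        (fun n : ℕ =>
          Real.log (expVal G n x (fun y => Real.exp (s * (y - a n) / b n))))
        Filter.atTop (nhds (s ^ 2 / 2)) := by
  intro s
  have hP := hasPoleExpansion_of_dirichletSeries hm hΦc hsum hval
  have hα0 : 0 < α := by linarith
  have hκ : 0 < x * (Real.Gamma α * (γ / (m - 1).factorial)) :=
    mul_pos hx (mul_pos (Real.Gamma_pos_of_pos hα0) (by positivity))
  have htz := tendsto_of_expSum_eq hP.nonneg hP.expSummable hx ht
  have hn : Filter.Tendsto (fun n : ℕ => (n : ℝ) / poleScale α (m - 1) (t n)) Filter.atTop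
      (nhds (x * (Real.Gamma α * (γ / (m - 1).factorial)))) := by
    have h := ((hP.tendsto_expSum_nhdsGT (if_pos rfl) (β := 0) (by linarith)).comp htz).const_mul x
    rw [add_zero] at h
    refine h.congr' ?_
    filter_upwards [Filter.eventually_ge_atTop 1] with n h1
    have h2 : expSum (fun δ => (aCount G (δ + 1) : ℝ)) 0 (t n) = n / x := (ht n h1).2
    rw [Function.comp_apply, Real.rpow_zero, mul_one, h2, ← mul_div_assoc, mul_div_cancel₀ _ hx.ne']
  rw [← Nat.cast_pred hm] at ha hb
  rw [mul_div_assoc] at hb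
  have hb' := tendsto_scaled_normalization htz hκ (by linarith) hn hb
  have ha' : Filter.Tendsto (fun n => (a n - x * Wfun G (-1) (t n)) / devScale α (m - 1) (t n))
      Filter.atTop (nhds 0) := by
    have h := ha.mul (tendsto_normalizer htz hκ hα0 hn)
    rw [zero_mul] at h
    refine h.congr' ?_
    filter_upwards [Filter.eventually_ge_atTop 2] with n h1
    have h2 : (1 : ℝ) < n := by exact_mod_cast h1
    have h3 := Real.log_pos h2
    exact div_mul_div_cancel₀ (by positivity)
  have hlim := tendsto_log_expCoeff_ratio hP (if_pos rfl) hγ hα hc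
    (fun δ => by simpa using hgrowth (δ + 1) δ.succ_pos) hx ht hbpos hb' ha'
    isExpCoeff_homWeight (fun y hy n => homWeight_pos (G := G) (Fin n) hy) s
  refine hlim.congr fun n => ?_
  rw [expVal_exp_affine, Real.log_mul (Real.exp_ne_zero _), Real.log_exp]
  exact (div_pos (homWeight_pos _ (mul_pos hx (Real.exp_pos _))) (homWeight_pos _ hx)).ne'
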